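/- arXiv:1311.5963 — 3 statements merged into one kernel-verified Lean document; each statement's English description precedes it below -/
import Mathlib

section
/- Let c : ℕ → Fin (n+1) → ℕ be any function such that for every e ≥ 1 there is an isomorphism of R-modules ᵉR ≅ ⊕_{i=0}^{n} M_i^{⊕ c(e,i)}. Then for every i, the sequence c(e,i)/p^{de} converges as e → ∞, with limit (dim_k V_i)/|G| (equivalently (rank_R M_i)/|G|). -/
/-!
Setting: `k` algebraically closed field of characteristic `p > 0`, `S = k[x_1, …, x_d]`
(the symmetric algebra of a `d`-dimensional vector space `V`), `G` a finite group acting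
faithfully on `S` by `k`-algebra automorphisms which send each variable into the linear span
of the variables (i.e. the action is induced by a linear action on `V = ⟨x_1, …, x_d⟩`,
so `G ⊆ GL(V)`), with `p ∤ |G|` and no pseudo-reflections.
`R = S^G` and `M_i = (S ⊗_k V_i)^G` where `V_0 = k, V_1, …, V_n` is a complete set of
pairwise non-isomorphic irreducible `kG`-modules.
The hypothesis states that `ᵉR ≅ ⊕ M_i^{⊕ c(e,i)}` as `R`-modules (an additive isomorphism
`φ` satisfying `φ (r^{p^e} * x) = r • φ x`, which is exactly `R`-linearity from the Frobenius
twist `ᵉR`), and the conclusion is `c(e,i)/p^{de} → dim_k V_i / |G|`.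
-/

set_option linter.unusedSectionVars false
set_option synthInstance.maxHeartbeats 1000000
set_option maxHeartbeats 1600000

open MvPolynomial TensorProduct

section Defs

variable (k : Type) [Field k] (d : ℕ) (G : Type) [Group G] [Fintype G]
variable [MulSemiringAction G (MvPolynomial (Fin d) k)]
variable [SMulCommClass G k (MvPolynomial (Fin d) k)]

/-- The invariant subring `R = S^G` as a subalgebra of `S = k[x_1, …, x_d]`. -/
def invariantSubalgebra : Subalgebra k (MvPolynomial (Fin d) k) where
  carrier := MulAction.fixedPoints G (MvPolynomial (Fin d) k)
  mul_mem' := by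
    intro a b ha hb g
    rw [smul_mul', ha g, hb g]
  add_mem' := by
    intro a b ha hb g
    rw [smul_add, ha g, hb g]
  algebraMap_mem' := by
    intro c g
    rw [Algebra.algebraMap_eq_smul_one, smul_comm, smul_one]

variable (W : Type) [AddCommGroup W] [Module k W] [DistribMulAction G W] [SMulCommClass G k W]

/-- The diagonal action of `g ∈ G` on `S ⊗_k W`. -/
noncomputable def diagAction (g : G) :
    (MvPolynomial (Fin d) k ⊗[k] W) →ₗ[k] (MvPolynomial (Fin d) k ⊗[k] W) :=
  TensorProduct.map (DistribMulAction.toLinearMap k _ g) (DistribMulAction.toLinearMap k W g)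

theorem diagAction_smul (g : G) (s : MvPolynomial (Fin d) k) (x : MvPolynomial (Fin d) k ⊗[k] W) :
    diagAction k d G W g (s • x) = (g • s) • diagAction k d G W g x := by
  induction x using TensorProduct.induction_on with
  | zero => simp
  | tmul s' w =>
      simp only [TensorProduct.smul_tmul', diagAction, TensorProduct.map_tmul,
        DistribMulAction.toLinearMap, DistribSMul.toLinearMap_apply, smul_eq_mul, smul_mul']
  | add x y hx hy =>
      simp only [smul_add, map_add, hx, hy]

/-- `(S ⊗_k W)^G` (invariants of the diagonal action) as a module over `R = S^G`. -/
noncomputable def invariantsTensor : Submodule (invariantSubalgebra k d G)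
    (MvPolynomial (Fin d) k ⊗[k] W) where
  carrier := {x | ∀ g : G, diagAction k d G W g x = x}
  add_mem' := by
    intro a b ha hb g
    rw [map_add, ha g, hb g]
  zero_mem' := by intro g; rw [map_zero]
  smul_mem' := by
    intro r x hx g
    have h : (r : MvPolynomial (Fin d) k) • x = r • x := rfl
    rw [← h, diagAction_smul, r.2 g, hx g]

/-- A representation of `G` over `k` is irreducible if it is nonzero and has no nontrivial
`G`-stable subspaces. -/
def IsIrreducibleRep (M : Type) [AddCommGroup M] [Module k M] [DistribMulAction G M]
    [SMulCommClass G k M] : Prop :=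
  Nontrivial M ∧
    ∀ N : Submodule k M, (∀ g : G, ∀ x ∈ N, g • x ∈ N) → N = ⊥ ∨ N = ⊤

/-- Two representations of `G` over `k` are isomorphic if there is a `G`-equivariant
`k`-linear equivalence between them. -/
def IsRepIso (M M' : Type) [AddCommGroup M] [Module k M] [DistribMulAction G M]
    [SMulCommClass G k M] [AddCommGroup M'] [Module k M'] [DistribMulAction G M']
    [SMulCommClass G k M'] : Prop :=
  ∃ φ : M ≃ₗ[k] M', ∀ (g : G) (x : M), φ (g • x) = g • φ x

end Defs


section Ext

theorem act_add {S N : Type} [CommRing S] [AddCommGroup N] (α : S →+* AddMonoid.End N)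
    (s t : S) (n : N) : α (s + t) n = α s n + α t n := by
  rw [map_add]; rfl

theorem act_mul {S N : Type} [CommRing S] [AddCommGroup N] (α : S →+* AddMonoid.End N)
    (s t : S) (n : N) : α (s * t) n = α s (α t n) := by
  rw [map_mul]; rfl

theorem act_zero {S N : Type} [CommRing S] [AddCommGroup N] (α : S →+* AddMonoid.End N)
    (n : N) : α 0 n = 0 := by
  rw [map_zero]; rfl

theorem act_neg {S N : Type} [CommRing S] [AddCommGroup N] (α : S →+* AddMonoid.End N)
    (s : S) (n : N) : α (-s) n = - α s n := by
  rw [map_neg]; rfl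

theorem act_sum {S N J : Type} [CommRing S] [AddCommGroup N] (α : S →+* AddMonoid.End N)
    (t : Finset J) (s : J → S) (n : N) : α (∑ j ∈ t, s j) n = ∑ j ∈ t, α (s j) n := by
  classical
  induction t using Finset.induction_on with
  | empty => simp
  | insert a t ha ih => rw [Finset.sum_insert ha, Finset.sum_insert ha, act_add, ih]

variable {G S : Type} [Group G] [Fintype G] [CommRing S] [MulSemiringAction G S]

/-- Chase-Harrison-Rosenberg type systems with denominator `a`. -/
def IsCHR (G : Type) {S : Type} [Group G] [Fintype G] [CommRing S] [MulSemiringAction G S]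
    (a : S) : Prop :=
  ∃ (I : Finset (Finset G)) (x y : Finset G → S), ∀ g : G,
    (g = 1 → ∑ i ∈ I, x i * g • y i = a) ∧ (g ≠ 1 → ∑ i ∈ I, x i * g • y i = 0)

theorem isCHR_prod [DecidableEq G] (s : G → S) :
    IsCHR G (∏ g ∈ Finset.univ.erase (1 : G), (s g - g⁻¹ • s g)) := by
  refine ⟨(Finset.univ.erase (1 : G)).powerset, fun U => ∏ g ∈ U, s g,
    fun U => ∏ g ∈ (Finset.univ.erase (1 : G)) \ U, (- (g⁻¹ • s g)), fun h => ?_⟩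
  have key : ∑ i ∈ (Finset.univ.erase (1 : G)).powerset, (∏ g ∈ i, s g) *
      h • ∏ g ∈ (Finset.univ.erase (1 : G)) \ i, (- (g⁻¹ • s g)) =
      ∏ g ∈ Finset.univ.erase (1 : G), (s g + - (h • g⁻¹ • s g)) := by
    rw [Finset.prod_add]
    refine Finset.sum_congr rfl fun U _ => ?_
    rw [Finset.smul_prod']
    simp only [smul_neg]
  rw [key]
  constructor
  · rintro rfl
    simp only [one_smul, sub_eq_add_neg]
  · intro hh
    apply Finset.prod_eq_zero (i := h)
    · simp [hh]
    · simp

variable {N M N' : Type} [AddCommGroup N] [AddCommGroup M] [AddCommGroup N']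
  (α : S →+* AddMonoid.End N) (γ : G →* AddMonoid.End N)
  (hγ : ∀ g s n, γ g (α s n) = α (g • s) (γ g n))
  (ι : M →+ N) (hι : Function.Injective ι) (hinv : ∀ m g, γ g (ι m) = ι m)
  (hsurj : ∀ n, (∀ g, γ g n = n) → ∃ m, ι m = n)
  (α' : S →+* AddMonoid.End N')

include hγ in
theorem chr_expand {a : S} {I : Finset (Finset G)} {x y : Finset G → S}
    (h : ∀ g : G,
    (g = 1 → ∑ i ∈ I, x i * g • y i = a) ∧ (g ≠ 1 → ∑ i ∈ I, x i * g • y i = 0)) (n : N) :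
    ∑ i ∈ I, α (x i) (∑ g, γ g (α (y i) n)) = α a n := by
  classical
  have : ∀ i, α (x i) (∑ g, γ g (α (y i) n)) = ∑ g, α (x i * g • y i) (γ g n) := by
    intro i
    rw [map_sum]
    refine Finset.sum_congr rfl fun g _ => ?_
    rw [hγ, map_mul]; rfl
  simp only [this]
  rw [Finset.sum_comm]
  have h2 : ∀ g, ∑ i ∈ I, α (x i * g • y i) (γ g n) = α (∑ i ∈ I, x i * g • y i) (γ g n) := by
    intro g
    rw [act_sum]
  simp only [h2]
  rw [Finset.sum_eq_single 1]
  · rw [(h 1).1 rfl]; simp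
  · intro g _ hg
    rw [(h g).2 hg]; simp
  · simp

include hsurj in
theorem exists_trace : ∃ T : N → M, ∀ n, ι (T n) = ∑ g, γ g n := by
  have : ∀ n, ∃ m, ι m = ∑ g, γ g n := by
    intro n
    apply hsurj
    intro g
    rw [map_sum]
    rw [← Equiv.sum_comp (Equiv.mulLeft g) (fun h => γ h n)]
    simp [map_mul]
  choose T hT using this
  exact ⟨T, hT⟩

include hγ hinv hsurj in
theorem ext_unique {a : S} (ha : IsCHR G a) (htf : ∀ v, α' a v = 0 → v = 0)
    (F₁ F₂ : N →+ N') (h₁ : ∀ s n, F₁ (α s n) = α' s (F₁ n))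
    (h₂ : ∀ s n, F₂ (α s n) = α' s (F₂ n)) (h : ∀ m, F₁ (ι m) = F₂ (ι m)) : F₁ = F₂ := by
  obtain ⟨I, x, y, hxy⟩ := ha
  obtain ⟨T, hT⟩ := exists_trace γ ι hsurj
  ext n
  rw [← sub_eq_zero]
  apply htf
  rw [map_sub, ← h₁, ← h₂, ← chr_expand α γ hγ hxy n]
  simp only [map_sum F₁, map_sum F₂, h₁, h₂, ← hT, h]
  simp

def trS (G : Type) {S : Type} [Group G] [Fintype G] [CommRing S] [MulSemiringAction G S]
  (s : S) : S := ∑ g : G, g • s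

theorem trS_inv (s : S) (g : G) : g • trS G s = trS G s := by
  unfold trS
  rw [Finset.smul_sum, ← Equiv.sum_comp (Equiv.mulLeft g) (fun h => h • s)]
  simp [mul_smul]

variable (f : M →+ N')
  (hf : ∀ (r : S), (∀ g : G, g • r = r) → ∀ m m', ι m' = α r (ι m) → f m' = α' r (f m))

include hγ hι hinv hsurj hf in
theorem ext_rel {a : S} (ha : IsCHR G a) (htf : ∀ v, α' a v = 0 → v = 0)
    {J : Type} (t : Finset J) (s : J → S) (m : J → M)
    (h : ∑ j ∈ t, α (s j) (ι (m j)) = 0) : ∑ j ∈ t, α' (s j) (f (m j)) = 0 := by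
  obtain ⟨I, x, y, hxy⟩ := ha
  have h1 : ∀ j (u : S), ∃ m', ι m' = α (trS G u) (ι (m j)) := by
    intro j u
    apply hsurj
    intro g
    rw [hγ, hinv, trS_inv]
  choose m' hm' using h1
  have h2 : ∀ u, ∑ j ∈ t, α' (trS G (u * s j)) (f (m j)) = 0 := by
    intro u
    have : ∑ j ∈ t, m' j (u * s j) = 0 := by
      apply hι
      rw [map_sum, map_zero]
      have h3 : ∑ g, γ g (α u (∑ j ∈ t, α (s j) (ι (m j)))) = 0 := by simp [h]
      rw [← h3]
      simp only [map_sum, hm']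
      rw [Finset.sum_comm]
      refine Finset.sum_congr rfl fun j _ => ?_
      rw [trS, act_sum]
      refine Finset.sum_congr rfl fun g _ => ?_
      rw [show α u (α (s j) (ι (m j))) = α (u * s j) (ι (m j)) by rw [map_mul]; rfl, hγ, hinv]
    have h4 := congrArg f this
    rw [map_sum, map_zero] at h4
    rw [← h4]
    refine Finset.sum_congr rfl fun j _ => ?_
    exact (hf _ (trS_inv _) _ _ (hm' j _)).symm
  apply htf
  have h5 : ∀ u : S, ∑ i ∈ I, x i * trS G (y i * u) = a * u := by
    intro u
    have := chr_expand (N := S) (Module.toAddMonoidEnd S S) (DistribMulAction.toAddMonoidEnd G S)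
      (fun g s n => smul_mul' g s n) hxy u
    exact this
  have h6 : α' a (∑ j ∈ t, α' (s j) (f (m j))) =
      ∑ i ∈ I, α' (x i) (∑ j ∈ t, α' (trS G (y i * s j)) (f (m j))) := by
    simp only [map_sum (α' _)]
    rw [Finset.sum_comm]
    refine Finset.sum_congr rfl fun j _ => ?_
    have := congrArg (fun z => α' z (f (m j))) (h5 (s j))
    simp only [act_sum, act_mul] at this
    exact this.symm
  rw [h6]
  simp [h2]

include hγ hι hinv hsurj hf in
theorem ext_exists {a : S} (ha : IsCHR G a) (htf : ∀ v, α' a v = 0 → v = 0)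
    (hdiv : ∀ v, (∀ b, IsCHR G b → ∃ w, α' b v = α' a w) → ∃ u, v = α' a u) :
    ∃ F : N →+ N', (∀ s n, F (α s n) = α' s (F n)) ∧ ∀ m, F (ι m) = f m := by
  obtain ⟨T, hT⟩ := exists_trace γ ι hsurj
  have ha' := ha
  obtain ⟨I, x, y, hxy⟩ := ha
  set Fa : N → N' := fun n => ∑ i ∈ I, α' (x i) (f (T (α (y i) n))) with hFa
  -- the key principle: compare two expansions
  have key : ∀ (J₁ J₂ : Finset (Finset G)) (s₁ s₂ : Finset G → S) (m₁ m₂ : Finset G → M),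
      ∑ j ∈ J₁, α (s₁ j) (ι (m₁ j)) = ∑ j ∈ J₂, α (s₂ j) (ι (m₂ j)) →
      ∑ j ∈ J₁, α' (s₁ j) (f (m₁ j)) = ∑ j ∈ J₂, α' (s₂ j) (f (m₂ j)) := by
    intro J₁ J₂ s₁ s₂ m₁ m₂ h
    have := ext_rel α γ hγ ι hι hinv hsurj α' f hf ha' htf (J₁.disjSum J₂)
      (Sum.elim s₁ (fun j => - s₂ j)) (Sum.elim m₁ m₂) (by
        rw [Finset.sum_disjSum]
        simp only [Sum.elim_inl, Sum.elim_inr, act_neg, Finset.sum_neg_distrib, h]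
        exact add_neg_cancel _)
    rw [Finset.sum_disjSum] at this
    simp only [Sum.elim_inl, Sum.elim_inr, act_neg,
      Finset.sum_neg_distrib] at this
    exact add_neg_eq_zero.mp this
  have hex : ∀ n, ∑ i ∈ I, α (x i) (ι (T (α (y i) n))) = α a n := by
    intro n
    simp only [hT]
    exact chr_expand α γ hγ hxy n
  have hcomp : ∀ s t n, α (s * t) n = α s (α t n) := by
    intro s t n; rw [map_mul]; rfl
  have hcomp' : ∀ s t n, α' (s * t) n = α' s (α' t n) := by
    intro s t n; rw [map_mul]; rfl
  have hFs : ∀ s n, Fa (α s n) = α' s (Fa n) := by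
    intro s n
    have := key I I x (fun i => s * x i) (fun i => T (α (y i) (α s n)))
      (fun i => T (α (y i) n)) (by
        rw [hex]
        simp only [hcomp, ← map_sum]
        rw [hex, ← hcomp, ← hcomp, mul_comm])
    simp only [hcomp', ← map_sum] at this
    exact this
  have hadd : ∀ n₁ n₂, Fa (n₁ + n₂) = Fa n₁ + Fa n₂ := by
    intro n₁ n₂
    simp only [hFa]
    rw [← Finset.sum_add_distrib]
    refine Finset.sum_congr rfl fun i _ => ?_
    rw [← map_add, ← map_add]
    congr 2
    apply hι
    simp only [map_add, hT, Finset.sum_add_distrib]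
  have hFm : ∀ m, Fa (ι m) = α' a (f m) := by
    intro m
    have := key I {∅} x (fun _ => a) (fun i => T (α (y i) (ι m))) (fun _ => m) (by
        rw [hex]; simp)
    simpa using this
  have hdv : ∀ n, ∃ u, Fa n = α' a u := by
    intro n
    apply hdiv
    rintro b ⟨I', x', y', hxy'⟩
    refine ⟨∑ i ∈ I', α' (x' i) (f (T (α (y' i) n))), ?_⟩
    have := key I I' (fun i => b * x i) (fun i => a * x' i) (fun i => T (α (y i) n))
      (fun i => T (α (y' i) n)) (by
        simp only [hcomp, ← map_sum]
        rw [hex]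
        simp only [hT]
        rw [chr_expand α γ hγ hxy', ← hcomp, ← hcomp, mul_comm])
    simpa only [hcomp', ← map_sum] using this
  choose F hF using hdv
  have hcancel : ∀ u v, α' a u = α' a v → u = v := by
    intro u v h
    rw [← sub_eq_zero]
    apply htf
    rw [map_sub, h, sub_self]
  refine ⟨AddMonoidHom.mk' F ?_, ?_, ?_⟩
  · intro n₁ n₂
    apply hcancel
    rw [← hF, hadd, hF, hF, map_add]
  · intro s n
    apply hcancel
    change α' a (F _) = α' a (α' s (F n))
    rw [← hF, hFs, hF, ← hcomp', ← hcomp', mul_comm]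
  · intro m
    apply hcancel
    change α' a (F _) = _
    rw [← hF, hFm]
end Ext

section Geo
variable {k : Type} [Field k] {d : ℕ} {G : Type} [Group G] [Fintype G]
  [MulSemiringAction G (MvPolynomial (Fin d) k)]
  [SMulCommClass G k (MvPolynomial (Fin d) k)]

theorem smul_C_eq (g : G) (c : k) : g • (C c : MvPolynomial (Fin d) k) = C c := by
  rw [← mul_one (C c), ← MvPolynomial.smul_eq_C_mul, smul_comm, smul_one]

theorem smul_eq_of_X (g : G) (h : ∀ j, g • (X j : MvPolynomial (Fin d) k) = X j)
    (s : MvPolynomial (Fin d) k) : g • s = s := by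
  induction s using MvPolynomial.induction_on with
  | C a => exact smul_C_eq g a
  | add p q hp hq => rw [smul_add, hp, hq]
  | mul_X p i hp => rw [smul_mul', hp, h]

theorem exists_not_dvd
    (hlin : ∀ (g : G) (j : Fin d),
      g • (X j : MvPolynomial (Fin d) k) ∈ Submodule.span k (Set.range X))
    (hfaithful : ∀ g : G, (∀ s : MvPolynomial (Fin d) k, g • s = s) → g = 1)
    (hps : ∀ g : G, g ≠ 1 → Module.finrank k
      (Submodule.span k (Set.range fun j : Fin d =>
        g • (X j : MvPolynomial (Fin d) k) - X j)) ≠ 1)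
    (g : G) (hg : g ≠ 1) (π : MvPolynomial (Fin d) k) (hπ : Prime π) :
    ∃ s : MvPolynomial (Fin d) k, ¬ π ∣ (s - g • s) := by
  by_contra! hall
  apply hps g hg
  set Sp := Submodule.span k (Set.range fun j : Fin d =>
        g • (X j : MvPolynomial (Fin d) k) - X j) with hSp
  have hdvd : ∀ l ∈ Sp, π ∣ l := by
    intro l hl
    induction hl using Submodule.span_induction with
    | mem x hx =>
      obtain ⟨j, rfl⟩ := hx
      have := hall (X j)
      rw [← dvd_neg, neg_sub] at this
      exact this
    | zero => exact dvd_zero _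
    | add x y _ _ hx hy => exact dvd_add hx hy
    | smul c x _ hx => rw [MvPolynomial.smul_eq_C_mul]; exact hx.mul_left _
  have hSpan : Submodule.span k (Set.range (X : Fin d → MvPolynomial (Fin d) k)) ≤
      homogeneousSubmodule (Fin d) k 1 := by
    rw [Submodule.span_le]
    rintro _ ⟨j, rfl⟩
    exact isHomogeneous_X k j
  have hSp1 : Sp ≤ homogeneousSubmodule (Fin d) k 1 := by
    rw [hSp, Submodule.span_le]
    rintro _ ⟨j, rfl⟩
    exact Submodule.sub_mem _ (hSpan (hlin g j)) (hSpan (Submodule.subset_span ⟨j, rfl⟩))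
  have hdeg : ∀ l ∈ Sp, l ≠ 0 → ∃ c : k, l = c • π := by
    intro l hl hl0
    obtain ⟨m, rfl⟩ := hdvd l hl
    have hm0 : m ≠ 0 := right_ne_zero_of_mul hl0
    have h1 := (hSp1 hl : IsHomogeneous _ 1).totalDegree hl0
    rw [totalDegree_mul_of_isDomain hπ.ne_zero hm0] at h1
    have h2 : π.totalDegree ≠ 0 := by
      intro h0
      rw [totalDegree_eq_zero_iff_eq_C] at h0
      apply hπ.not_isUnit
      rw [h0]
      apply IsUnit.map
      rw [isUnit_iff_ne_zero]
      intro h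
      rw [h, C_0] at h0
      exact hπ.ne_zero h0
    have h3 : m.totalDegree = 0 := by omega
    rw [totalDegree_eq_zero_iff_eq_C] at h3
    refine ⟨m.coeff 0, ?_⟩
    rw [MvPolynomial.smul_eq_C_mul, ← h3, mul_comm]
  have hle : Sp ≤ Submodule.span k {π} := by
    intro l hl
    by_cases h0 : l = 0
    · rw [h0]; exact Submodule.zero_mem _
    · obtain ⟨c, rfl⟩ := hdeg l hl h0
      exact Submodule.smul_mem _ _ (Submodule.mem_span_singleton_self _)
  have hne : Sp ≠ ⊥ := by
    intro hbot
    apply hg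
    apply hfaithful
    apply smul_eq_of_X
    intro j
    have : g • (X j : MvPolynomial (Fin d) k) - X j ∈ Sp := Submodule.subset_span ⟨j, rfl⟩
    rw [hbot, Submodule.mem_bot, sub_eq_zero] at this
    exact this
  have h1 : Module.finrank k Sp ≤ 1 := by
    rw [← finrank_span_singleton (K := k) hπ.ne_zero]
    exact Submodule.finrank_mono hle
  have h2 : Module.finrank k Sp ≠ 0 := by
    have : FiniteDimensional k Sp := Submodule.finiteDimensional_of_le hle
    rw [Ne, Submodule.finrank_eq_zero]
    exact hne
  omega

theorem exists_chr_not_dvd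
    (hlin : ∀ (g : G) (j : Fin d),
      g • (X j : MvPolynomial (Fin d) k) ∈ Submodule.span k (Set.range X))
    (hfaithful : ∀ g : G, (∀ s : MvPolynomial (Fin d) k, g • s = s) → g = 1)
    (hps : ∀ g : G, g ≠ 1 → Module.finrank k
      (Submodule.span k (Set.range fun j : Fin d =>
        g • (X j : MvPolynomial (Fin d) k) - X j)) ≠ 1)
    (π : MvPolynomial (Fin d) k) (hπ : Prime π) :
    ∃ b : MvPolynomial (Fin d) k, IsCHR G b ∧ ¬ π ∣ b := by
  classical
  have h : ∀ g : G, ∃ s : MvPolynomial (Fin d) k, g ≠ 1 → ¬ π ∣ (s - g⁻¹ • s) := by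
    intro g
    by_cases hg : g = 1
    · exact ⟨0, fun h => absurd hg h⟩
    · obtain ⟨s, hs⟩ := exists_not_dvd hlin hfaithful hps g⁻¹ (inv_ne_one.mpr hg) π hπ
      exact ⟨s, fun _ => hs⟩
  choose s hs using h
  refine ⟨_, isCHR_prod s, ?_⟩
  intro hd
  obtain ⟨g, hg, hgd⟩ := hπ.exists_mem_finset_dvd hd
  exact hs g (Finset.ne_of_mem_erase hg) hgd

theorem exists_chr_ne_zero
    (hfaithful : ∀ g : G, (∀ s : MvPolynomial (Fin d) k, g • s = s) → g = 1) :
    ∃ b : MvPolynomial (Fin d) k, IsCHR G b ∧ b ≠ 0 := by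
  classical
  have h : ∀ g : G, ∃ s : MvPolynomial (Fin d) k, g ≠ 1 → (s - g⁻¹ • s) ≠ 0 := by
    intro g
    by_cases hg : g = 1
    · exact ⟨0, fun h => absurd hg h⟩
    · by_contra! hs
      apply hg
      rw [← inv_eq_one]
      exact hfaithful _ fun s => (sub_eq_zero.mp (hs s).2).symm
  choose s hs using h
  refine ⟨_, isCHR_prod s, ?_⟩
  rw [Finset.prod_ne_zero_iff]
  intro g hg
  exact hs g (Finset.ne_of_mem_erase hg)

theorem pow_dvd_of_chr
    (hlin : ∀ (g : G) (j : Fin d),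
      g • (X j : MvPolynomial (Fin d) k) ∈ Submodule.span k (Set.range X))
    (hfaithful : ∀ g : G, (∀ s : MvPolynomial (Fin d) k, g • s = s) → g = 1)
    (hps : ∀ g : G, g ≠ 1 → Module.finrank k
      (Submodule.span k (Set.range fun j : Fin d =>
        g • (X j : MvPolynomial (Fin d) k) - X j)) ≠ 1)
    (q : ℕ) (a v : MvPolynomial (Fin d) k) (ha : a ≠ 0)
    (h : ∀ b : MvPolynomial (Fin d) k, IsCHR G b → a ∣ b ^ q * v) : a ∣ v := by
  obtain ⟨a', v', c, hrel, h1, h2⟩ := UniqueFactorizationMonoid.exists_reduced_factors a ha v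
  have hc0 : c ≠ 0 := by rintro rfl; simp at h1; exact ha h1.symm
  have ha'0 : a' ≠ 0 := by rintro rfl; simp at h1; exact ha h1.symm
  have h3 : ∀ b : MvPolynomial (Fin d) k, IsCHR G b → a' ∣ b ^ q := by
    intro b hb
    have := h b hb
    rw [← h1, ← h2, mul_left_comm] at this
    exact hrel.dvd_of_dvd_mul_right ((mul_dvd_mul_iff_left hc0).mp this)
  have hu : IsUnit a' := by
    by_contra hu
    obtain ⟨π, hπ, hdv⟩ := WfDvdMonoid.exists_irreducible_factor hu ha'0
    obtain ⟨b, hb, hnd⟩ := exists_chr_not_dvd hlin hfaithful hps π hπ.prime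
    exact hnd (hπ.prime.dvd_of_dvd_pow (hdv.trans (h3 b hb)))
  rw [← h1, ← h2]
  obtain ⟨u, rfl⟩ := hu
  exact mul_dvd_mul_left c (Units.coe_dvd)
end Geo

section LiftN
variable (k : Type) [Field k] (d n : ℕ) (G : Type) [Group G] [Fintype G]
  [MulSemiringAction G (MvPolynomial (Fin d) k)]
  [SMulCommClass G k (MvPolynomial (Fin d) k)]
  (W : Fin (n + 1) → Type) [∀ i, AddCommGroup (W i)] [∀ i, Module k (W i)]
  [∀ i, DistribMulAction G (W i)] [∀ i, SMulCommClass G k (W i)] (c : Fin (n + 1) → ℕ)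

theorem diagAction_one (V : Type) [AddCommGroup V] [Module k V] [DistribMulAction G V]
    [SMulCommClass G k V] (x : MvPolynomial (Fin d) k ⊗[k] V) : diagAction k d G V 1 x = x := by
  induction x using TensorProduct.induction_on with
  | zero => simp
  | tmul s w =>
    change ((1 : G) • s) ⊗ₜ[k] ((1 : G) • w) = _
    rw [one_smul, one_smul]
  | add x y hx hy => rw [map_add, hx, hy]

theorem diagAction_mul (V : Type) [AddCommGroup V] [Module k V] [DistribMulAction G V]
    [SMulCommClass G k V] (g h : G) (x : MvPolynomial (Fin d) k ⊗[k] V) :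
    diagAction k d G V (g * h) x = diagAction k d G V g (diagAction k d G V h x) := by
  induction x using TensorProduct.induction_on with
  | zero => simp
  | tmul s w =>
    change ((g * h) • s) ⊗ₜ[k] ((g * h) • w) = (g • h • s) ⊗ₜ[k] (g • h • w)
    rw [mul_smul, mul_smul]
  | add x y hx hy => rw [map_add, hx, hy, map_add, map_add]

/-- The module `⊕ (S ⊗ W_i)^{c_i}`. -/
abbrev NN : Type := ∀ i : Fin (n + 1), Fin (c i) → (MvPolynomial (Fin d) k ⊗[k] W i)

noncomputable def gammaN : G →* AddMonoid.End (NN k d n W c) where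
  toFun g := AddMonoidHom.mk' (fun x i l => diagAction k d G (W i) g (x i l)) (by
    intro x y
    funext i l
    exact map_add _ _ _)
  map_one' := by
    ext x i l
    exact diagAction_one k d G (W i) _
  map_mul' g h := by
    ext x i l
    exact diagAction_mul k d G (W i) g h _

theorem gammaN_apply (g : G) (x : NN k d n W c) (i) (l) :
    gammaN k d n G W c g x i l = diagAction k d G (W i) g (x i l) := rfl

noncomputable def evT (V : Type) [AddCommGroup V] [Module k V] :
    (MvPolynomial (Fin d) k ⊗[k] V) →ₗ[k] V :=
  TensorProduct.lift ((LinearMap.lsmul k V).comp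
    (MvPolynomial.aeval (fun _ => (0 : k)) : MvPolynomial (Fin d) k →ₐ[k] k).toLinearMap)

theorem evT_tmul (V : Type) [AddCommGroup V] [Module k V] (s : MvPolynomial (Fin d) k) (v : V) :
    evT k d V (s ⊗ₜ v) = constantCoeff s • v := by
  simp [evT, MvPolynomial.constantCoeff_eq]

theorem evT_smul (V : Type) [AddCommGroup V] [Module k V] (s : MvPolynomial (Fin d) k)
    (x : MvPolynomial (Fin d) k ⊗[k] V) :
    evT k d V (s • x) = constantCoeff s • evT k d V x := by
  induction x using TensorProduct.induction_on with
  | zero => simp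
  | tmul s' w => rw [TensorProduct.smul_tmul', evT_tmul, evT_tmul, smul_eq_mul, map_mul, mul_smul]
  | add x y hx hy => rw [smul_add, map_add, hx, hy, map_add, smul_add]

theorem constantCoeff_smul
    (hlin : ∀ (g : G) (j : Fin d),
      g • (X j : MvPolynomial (Fin d) k) ∈ Submodule.span k (Set.range X))
    (g : G) (s : MvPolynomial (Fin d) k) : constantCoeff (g • s) = constantCoeff s := by
  induction s using MvPolynomial.induction_on with
  | C a => rw [smul_C_eq]
  | add p q hp hq => rw [smul_add, map_add, map_add, hp, hq]
  | mul_X p i hp =>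
    rw [smul_mul', map_mul, map_mul, constantCoeff_X, mul_zero]
    have : constantCoeff (g • (X i : MvPolynomial (Fin d) k)) = 0 := by
      have h := hlin g i
      generalize g • (X i : MvPolynomial (Fin d) k) = y at h
      induction h using Submodule.span_induction with
      | mem x hx => obtain ⟨j, rfl⟩ := hx; simp
      | zero => simp
      | add x y _ _ hx hy => rw [map_add, hx, hy, add_zero]
      | smul c x _ hx => rw [MvPolynomial.smul_eq_C_mul, map_mul, hx, mul_zero]
    rw [this, mul_zero]

theorem evT_diag
    (hlin : ∀ (g : G) (j : Fin d),
      g • (X j : MvPolynomial (Fin d) k) ∈ Submodule.span k (Set.range X))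
    (V : Type) [AddCommGroup V] [Module k V] [DistribMulAction G V]
    [SMulCommClass G k V] (g : G) (x : MvPolynomial (Fin d) k ⊗[k] V) :
    evT k d V (diagAction k d G V g x) = g • evT k d V x := by
  induction x using TensorProduct.induction_on with
  | zero => simp
  | tmul s w =>
    rw [evT_tmul, smul_comm, ← constantCoeff_smul k d G hlin g s, ← evT_tmul]
    rfl
  | add x y hx hy => rw [map_add, map_add, hx, hy, map_add, smul_add]

theorem exists_X_decomp (s : MvPolynomial (Fin d) k) :
    ∃ z : Fin d → MvPolynomial (Fin d) k, s = C (constantCoeff s) + ∑ j, X j * z j := by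
  induction s using MvPolynomial.induction_on with
  | C a => exact ⟨0, by simp⟩
  | add p q hp hq =>
    obtain ⟨z, hz⟩ := hp
    obtain ⟨z', hz'⟩ := hq
    refine ⟨z + z', ?_⟩
    simp only [Pi.add_apply, mul_add, Finset.sum_add_distrib, map_add]
    nth_rewrite 1 [hz, hz']
    ring
  | mul_X p i hp =>
    refine ⟨Pi.single i p, ?_⟩
    rw [Finset.sum_eq_single i]
    · simp [mul_comm]
    · intro j _ hj; simp [hj]
    · simp

theorem evT_ker (V : Type) [AddCommGroup V] [Module k V] (x : MvPolynomial (Fin d) k ⊗[k] V) :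
    ∃ z : Fin d → MvPolynomial (Fin d) k ⊗[k] V,
      x = 1 ⊗ₜ evT k d V x + ∑ j, (X j : MvPolynomial (Fin d) k) • z j := by
  induction x using TensorProduct.induction_on with
  | zero => exact ⟨0, by simp⟩
  | tmul s w =>
    obtain ⟨z, hz⟩ := exists_X_decomp k d s
    refine ⟨fun j => z j ⊗ₜ w, ?_⟩
    rw [evT_tmul]
    nth_rewrite 1 [hz]
    simp only [TensorProduct.smul_tmul', TensorProduct.add_tmul, TensorProduct.sum_tmul,
      smul_eq_mul, ← TensorProduct.smul_tmul]
    congr 2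
    rw [MvPolynomial.smul_eq_C_mul, mul_one]
  | add x y hx hy =>
    obtain ⟨z, hz⟩ := hx
    obtain ⟨z', hz'⟩ := hy
    refine ⟨z + z', ?_⟩
    simp only [Pi.add_apply, smul_add, Finset.sum_add_distrib, map_add, TensorProduct.tmul_add]
    nth_rewrite 1 [hz, hz']
    abel

theorem free_dvd {S V ι : Type} [CommRing S] [AddCommGroup V] [Module S V]
    (b : Module.Basis ι S V) (a : S) (v : V) (h : ∀ i, a ∣ b.repr v i) : ∃ u, v = a • u := by
  choose f hf using h
  refine ⟨(b.repr v).sum fun i _ => f i • b i, ?_⟩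
  conv_lhs => rw [← b.linearCombination_repr v, Finsupp.linearCombination_apply]
  rw [Finsupp.smul_sum]
  refine Finset.sum_congr rfl fun i _ => ?_
  simp only []
  rw [smul_smul, ← hf]

theorem lift_main (p : ℕ) [Fact p.Prime] [CharP k p]
    (hlin : ∀ (g : G) (j : Fin d),
      g • (X j : MvPolynomial (Fin d) k) ∈ Submodule.span k (Set.range X))
    (hfaithful : ∀ g : G, (∀ s : MvPolynomial (Fin d) k, g • s = s) → g = 1)
    (hps : ∀ g : G, g ≠ 1 → Module.finrank k
      (Submodule.span k (Set.range fun j : Fin d =>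
        g • (X j : MvPolynomial (Fin d) k) - X j)) ≠ 1)
    (e : ℕ)
    (φ : invariantSubalgebra k d G ≃+
        (∀ i : Fin (n + 1), Fin (c i) → invariantsTensor k d G (W i)))
    (hφ : ∀ (r x : invariantSubalgebra k d G), φ (r ^ p ^ e * x) = r • φ x) :
    ∃ π : MvPolynomial (Fin d) k →+ (∀ i : Fin (n + 1), Fin (c i) → W i),
      Function.Surjective π ∧ (∀ (a : k) x, π (C (a ^ p ^ e) * x) = a • π x) ∧
      (∀ (g : G) x, π (g • x) = g • π x) ∧
      (∀ x, π x = 0 ↔ ∃ z : Fin d → MvPolynomial (Fin d) k, x = ∑ j, X j ^ p ^ e * z j) := by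
  set S := MvPolynomial (Fin d) k with hS
  set N := NN k d n W c
  set αN : S →+* AddMonoid.End N := Module.toAddMonoidEnd S N with hαN
  set αS : S →+* AddMonoid.End S :=
    (Module.toAddMonoidEnd S S).comp (iterateFrobenius S p e) with hαS
  set γN : G →* AddMonoid.End N := gammaN k d n G W c with hγN
  set γS : G →* AddMonoid.End S := DistribMulAction.toAddMonoidEnd G S with hγS
  have aN : ∀ s x, αN s x = s • x := fun _ _ => rfl
  have aS : ∀ s x, αS s x = s ^ p ^ e * x := fun _ _ => rfl
  have gS : ∀ g x, γS g x = g • x := fun _ _ => rfl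
  have hγNα : ∀ g s x, γN g (αN s x) = αN (g • s) (γN g x) := by
    intro g s x
    funext i l
    exact diagAction_smul k d G (W i) g s (x i l)
  have hγSα : ∀ g s x, γS g (αS s x) = αS (g • s) (γS g x) := by
    intro g s x
    simp only [aS, gS, smul_mul', smul_pow']
  let ιS : invariantSubalgebra k d G →+ S := (invariantSubalgebra k d G).val.toRingHom.toAddMonoidHom
  let ιN : (∀ i : Fin (n + 1), Fin (c i) → invariantsTensor k d G (W i)) →+ N :=
    AddMonoidHom.mk' (fun m i l => (m i l : S ⊗[k] W i)) (fun _ _ => rfl)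
  have iS : ∀ r, ιS r = (r : S) := fun _ => rfl
  have iN : ∀ m i l, ιN m i l = (m i l : S ⊗[k] W i) := fun _ _ _ => rfl
  have ιSinj : Function.Injective ιS := Subtype.val_injective
  have ιNinj : Function.Injective ιN := by
    intro m m' h
    funext i l
    apply Subtype.ext
    exact congrFun (congrFun h i) l
  have invS : ∀ m g, γS g (ιS m) = ιS m := fun m g => m.2 g
  have invN : ∀ m g, γN g (ιN m) = ιN m := by
    intro m g
    funext i l
    exact (m i l).2 g
  have surS : ∀ x, (∀ g, γS g x = x) → ∃ m, ιS m = x := fun x hx => ⟨⟨x, hx⟩, rfl⟩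
  have surN : ∀ x, (∀ g, γN g x = x) → ∃ m, ιN m = x := by
    intro x hx
    refine ⟨fun i l => ⟨x i l, fun g => congrFun (congrFun (hx g) i) l⟩, rfl⟩
  obtain ⟨a, ha, ha0⟩ := exists_chr_ne_zero (k := k) (d := d) hfaithful
  have tfS : ∀ v, αS a v = 0 → v = 0 := by
    intro v hv
    rw [aS] at hv
    exact (mul_eq_zero.mp hv).resolve_left (pow_ne_zero _ ha0)
  have tfN : ∀ v, αN a v = 0 → v = 0 := by
    intro v hv
    rw [aN] at hv
    funext i l
    have h1 : a • v i l = 0 := congrFun (congrFun hv i) l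
    let b := Algebra.TensorProduct.basis S (Module.Basis.ofVectorSpace k (W i))
    apply b.repr.injective
    change b.repr (v i l) = b.repr 0
    rw [map_zero]
    refine Finsupp.ext fun j => ?_
    have h2 := congrArg (fun z => b.repr z j) h1
    simp only [map_smul, map_zero, Finsupp.smul_apply, smul_eq_mul, Finsupp.zero_apply] at h2 ⊢
    exact (mul_eq_zero.mp h2).resolve_left ha0
  have dvS : ∀ v, (∀ b, IsCHR G b → ∃ w, αS b v = αS a w) → ∃ u, v = αS a u := by
    intro v hv
    exact pow_dvd_of_chr hlin hfaithful hps (p ^ e) (a ^ p ^ e) v (pow_ne_zero _ ha0)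
      (fun b hb => hv b hb)
  have dvN : ∀ v, (∀ b, IsCHR G b → ∃ w, αN b v = αN a w) → ∃ u, v = αN a u := by
    intro v hv
    have : ∀ i l, ∃ u, v i l = a • u := by
      intro i l
      apply free_dvd (Algebra.TensorProduct.basis S (Module.Basis.ofVectorSpace k (W i)))
      intro j
      apply pow_dvd_of_chr hlin hfaithful hps 1 a _ ha0
      intro b hb
      obtain ⟨w, hw⟩ := hv b hb
      have h1 : b • v i l = a • w i l := congrFun (congrFun hw i) l
      have h2 := congrArg (fun z => (Algebra.TensorProduct.basis S
        (Module.Basis.ofVectorSpace k (W i))).repr z j) h1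
      simp only [map_smul, Finsupp.smul_apply, smul_eq_mul] at h2
      rw [pow_one, h2]
      exact dvd_mul_right _ _
    choose u hu using this
    exact ⟨u, funext fun i => funext fun l => hu i l⟩
  obtain ⟨Φ, hΦs, hΦm⟩ := ext_exists αS γS hγSα ιS ιSinj invS surS αN (ιN.comp φ.toAddMonoidHom)
    (by
      intro r hr m m' hm
      have h1 : m' = (⟨r, hr⟩ : invariantSubalgebra k d G) ^ p ^ e * m := ιSinj hm
      change ιN (φ m') = αN r (ιN (φ m))
      rw [h1, hφ]
      rfl) ha tfN dvN
  have hfN : ∀ (r : S), (∀ g : G, g • r = r) → ∀ m m', ιN m' = αN r (ιN m) →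
      (ιS.comp φ.symm.toAddMonoidHom) m' = αS r ((ιS.comp φ.symm.toAddMonoidHom) m) := by
      intro r hr m m' hm
      change ιN m' = αN r (ιN m) at hm
      have h1 : m' = (⟨r, hr⟩ : invariantSubalgebra k d G) • m := ιNinj hm
      change ιS (φ.symm m') = αS r (ιS (φ.symm m))
      have h2 : φ.symm m' = (⟨r, hr⟩ : invariantSubalgebra k d G) ^ p ^ e * φ.symm m := by
        rw [AddEquiv.symm_apply_eq, hφ, AddEquiv.apply_symm_apply, h1]
      rw [h2]
      rfl
  obtain ⟨Ψ, hΨs, hΨm⟩ := ext_exists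
    (M := ∀ i : Fin (n + 1), Fin (c i) → invariantsTensor k d G (W i)) αN γN hγNα ιN ιNinj invN surN αS
    (ιS.comp φ.symm.toAddMonoidHom) hfN ha tfS dvS
  have hΨΦ : ∀ x, Ψ (Φ x) = x := by
    have := ext_unique αS γS hγSα ιS invS surS αS ha tfS (Ψ.comp Φ) (AddMonoidHom.id S)
      (by intro s x; simp only [AddMonoidHom.comp_apply]; rw [hΦs, hΨs])
      (by intro s x; rfl)
      (by
        intro m
        simp only [AddMonoidHom.comp_apply]
        rw [hΦm]
        change Ψ (ιN (φ m)) = _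
        rw [hΨm]
        change ιS (φ.symm (φ m)) = _
        rw [AddEquiv.symm_apply_apply]
        rfl)
    exact fun x => DFunLike.congr_fun this x
  have hΦΨ : ∀ x, Φ (Ψ x) = x := by
    have := ext_unique (M := ∀ i : Fin (n + 1), Fin (c i) → invariantsTensor k d G (W i)) αN γN hγNα ιN invN surN αN ha tfN (Φ.comp Ψ) (AddMonoidHom.id N)
      (by intro s x; simp only [AddMonoidHom.comp_apply]; rw [hΨs, hΦs])
      (by intro s x; rfl)
      (by
        intro m
        simp only [AddMonoidHom.comp_apply]
        rw [hΨm]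
        change Φ (ιS (φ.symm m)) = _
        rw [hΦm]
        change ιN (φ (φ.symm m)) = _
        rw [AddEquiv.apply_symm_apply]
        rfl)
    exact fun x => DFunLike.congr_fun this x
  have hΦg : ∀ g x, Φ (g • x) = γN g (Φ x) := by
    intro g
    have := ext_unique αS γS hγSα ιS invS surS αN ha tfN
      ((AddMonoidHom.comp (γN g⁻¹) Φ).comp (γS g)) Φ
      (by
        intro s x
        change γN g⁻¹ (Φ (γS g (αS s x))) = αN s (γN g⁻¹ (Φ (γS g x)))
        rw [hγSα, hΦs, hγNα, inv_smul_smul])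
      (by intro s x; rw [hΦs])
      (by
        intro m
        change γN g⁻¹ (Φ (γS g (ιS m))) = Φ (ιS m)
        rw [invS, hΦm]
        exact invN _ _)
    intro x
    have h1 : γN g⁻¹ (Φ (g • x)) = Φ x := DFunLike.congr_fun this x
    have h2 : ∀ y, γN g (γN g⁻¹ y) = y := by
      intro y
      change (γN g * γN g⁻¹) y = y
      rw [← map_mul, mul_inv_cancel, map_one]
      rfl
    rw [← h1, h2]
  let ev : N →+ (∀ i : Fin (n + 1), Fin (c i) → W i) :=
    AddMonoidHom.mk' (fun x i l => evT k d (W i) (x i l))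
      (fun x y => funext fun i => funext fun l => map_add _ _ _)
  have evE : ∀ x i l, ev x i l = evT k d (W i) (x i l) := fun _ _ _ => rfl
  refine ⟨ev.comp Φ, ?_, ?_, ?_, ?_⟩
  · intro u
    refine ⟨Ψ (fun i l => 1 ⊗ₜ u i l), ?_⟩
    simp only [AddMonoidHom.comp_apply]
    rw [hΦΨ]
    funext i l
    rw [evE, evT_tmul]
    simp
  · intro b x
    simp only [AddMonoidHom.comp_apply]
    have h1 : Φ (C (b ^ p ^ e) * x) = (C b : S) • Φ x := by
      rw [map_pow]
      exact hΦs (C b) x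
    rw [h1]
    funext i l
    rw [evE]
    change evT k d (W i) ((C b : S) • Φ x i l) = _
    rw [evT_smul, constantCoeff_C]
    rfl
  · intro g x
    simp only [AddMonoidHom.comp_apply]
    rw [hΦg]
    funext i l
    exact evT_diag k d G hlin (W i) g (Φ x i l)
  · intro x
    simp only [AddMonoidHom.comp_apply]
    constructor
    · intro h0
      have : ∀ i l, ∃ z : Fin d → S ⊗[k] W i, Φ x i l = ∑ j, (X j : S) • z j := by
        intro i l
        obtain ⟨z, hz⟩ := evT_ker k d (W i) (Φ x i l)
        refine ⟨z, ?_⟩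
        have h1 : evT k d (W i) (Φ x i l) = 0 := congrFun (congrFun h0 i) l
        rw [h1, TensorProduct.tmul_zero, zero_add] at hz
        exact hz
      choose z hz using this
      refine ⟨fun j => Ψ (fun i l => z i l j), ?_⟩
      have h2 : Φ x = ∑ j, αN (X j) (fun i l => z i l j) := by
        funext i l
        rw [hz i l, Finset.sum_apply, Finset.sum_apply]
        rfl
      rw [← hΨΦ x, h2, map_sum]
      refine Finset.sum_congr rfl fun j _ => ?_
      rw [hΨs]
      rfl
    · rintro ⟨z, rfl⟩
      rw [map_sum, map_sum]
      apply Finset.sum_eq_zero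
      intro j _
      have : Φ (X j ^ p ^ e * z j) = (X j : S) • Φ (z j) := hΦs (X j) (z j)
      rw [this]
      funext i l
      rw [evE]
      change evT k d (W i) ((X j : S) • Φ (z j) i l) = _
      rw [evT_smul, constantCoeff_X, zero_smul]
      rfl
end LiftN

section Dim
variable {k : Type} [Field k] {d : ℕ}

/-- exponent vector of a function with values below `q`. -/
noncomputable def mb {d q : ℕ} (β : Fin d → Fin q) : Fin d →₀ ℕ :=
  Finsupp.equivFunOnFinite.symm (fun j => (β j : ℕ))

theorem mb_apply {d q : ℕ} (β : Fin d → Fin q) (j : Fin d) : mb β j = (β j : ℕ) := rfl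

theorem mb_inj {d q : ℕ} : Function.Injective (mb : (Fin d → Fin q) → _) := by
  intro β β' h
  funext j
  apply Fin.ext
  rw [← mb_apply, ← mb_apply, h]

theorem card_bad (q : ℕ) (α : Fin d → ℕ) :
    Fintype.card {β : Fin d → Fin q // ¬ ∀ j, α j + β j < q} * q ≤ (∑ j, α j) * q ^ d := by
  classical
  have h1 : ∀ j, (Finset.univ.filter (fun β : Fin d → Fin q => q ≤ α j + β j)).card * q ≤
      α j * q ^ d := by
    intro j
    have : ((Finset.univ.filter (fun β : Fin d → Fin q => q ≤ α j + β j)) ×ˢ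
        (Finset.univ : Finset (Fin q))).card ≤
        (Finset.range (α j) ×ˢ (Finset.univ : Finset (Fin d → Fin q))).card := by
      apply Finset.card_le_card_of_injOn (fun x => (q - 1 - x.1 j, Function.update x.1 j x.2))
      · rintro ⟨β, r⟩ hx
        simp only [Finset.coe_product, Set.mem_prod, Finset.mem_coe, Finset.mem_filter,
          Finset.mem_univ, true_and, and_true, Finset.mem_range] at hx ⊢
        have := (β j).2
        omega
      · rintro ⟨β, r⟩ _ ⟨β', r'⟩ _ h
        simp only [Prod.mk.injEq] at h ⊢
        obtain ⟨ha, hb⟩ := h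
        constructor
        · funext i
          by_cases hi : i = j
          · subst hi
            have := (β i).2
            have := (β' i).2
            apply Fin.ext
            omega
          · have := congrFun hb i
            simpa [hi] using this
        · have := congrFun hb j
          simpa using this
    simpa [Finset.card_product] using this
  calc _ ≤ (∑ j, (Finset.univ.filter (fun β : Fin d → Fin q => q ≤ α j + β j)).card) * q := by
        apply Nat.mul_le_mul_right
        rw [Fintype.card_subtype]
        refine le_trans (Finset.card_le_card ?_) Finset.card_biUnion_le
        intro β hβ
        simpa using hβ
    _ ≤ _ := by
        rw [Finset.sum_mul, Finset.sum_mul]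
        exact Finset.sum_le_sum fun j _ => h1 j

variable {U : Type} [AddCommGroup U] [Module k U] (q : ℕ) (hq : 0 < q)
  (π : MvPolynomial (Fin d) k →+ U)
  (hsm : ∀ (a : k) x, π (C (a ^ q) * x) = a • π x)
  (hker : ∀ x, π x = 0 ↔ ∃ z : Fin d → MvPolynomial (Fin d) k, x = ∑ j, X j ^ q * z j)

include hker in
theorem coeff_of_ker (x : MvPolynomial (Fin d) k) (hx : π x = 0) (β : Fin d →₀ ℕ)
    (hβ : ∀ j, β j < q) : coeff β x = 0 := by
  obtain ⟨z, rfl⟩ := (hker x).mp hx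
  rw [coeff_sum]
  apply Finset.sum_eq_zero
  intro j _
  rw [X_pow_eq_monomial, coeff_monomial_mul', if_neg]
  intro h
  have := h j
  simp at this
  have := hβ j
  omega

include hsm hker hq in
theorem li_good (δ : MvPolynomial (Fin d) k) (hδ : δ ≠ 0) :
    LinearIndependent k (fun β : {β : Fin d → Fin q //
      ∀ j, (MonomialOrder.lex.degree δ) j + β j < q} => π (δ * monomial (mb β.1) 1)) := by
  classical
  rw [Fintype.linearIndependent_iff]
  intro l hl
  set h : MvPolynomial (Fin d) k := ∑ β : {β : Fin d → Fin q //
      ∀ j, (MonomialOrder.lex.degree δ) j + β j < q}, monomial (mb β.1) (l β ^ q) with hh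
  have h1 : π (δ * h) = 0 := by
    rw [← hl, hh, Finset.mul_sum, map_sum]
    refine Finset.sum_congr rfl fun β _ => ?_
    rw [← hsm, mul_left_comm, C_mul_monomial, mul_one]
  have hco : ∀ β, coeff (mb β.1) h = l β ^ q := by
    intro β
    rw [hh, coeff_sum, Finset.sum_eq_single β]
    · simp
    · intro β' _ hne
      rw [coeff_monomial, if_neg]
      intro he
      exact hne (Subtype.ext (mb_inj he))
    · simp
  have h0 : h = 0 := by
    by_contra hne
    have hs : MonomialOrder.lex.degree h ∈ h.support := MonomialOrder.lex.degree_mem_support hne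
    have hs' : ∃ β : {β : Fin d → Fin q //
      ∀ j, (MonomialOrder.lex.degree δ) j + β j < q}, MonomialOrder.lex.degree h = mb β.1 := by
      by_contra! hcon
      rw [mem_support_iff] at hs
      apply hs
      nth_rewrite 2 [hh]
      rw [coeff_sum]
      apply Finset.sum_eq_zero
      intro β _
      rw [coeff_monomial, if_neg]
      exact fun h => hcon β h.symm
    obtain ⟨β, hβ⟩ := hs'
    have h2 := coeff_of_ker q π hker _ h1
      (MonomialOrder.lex.degree δ + MonomialOrder.lex.degree h) (by
        intro j
        rw [hβ, Finsupp.add_apply, mb_apply]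
        exact β.2 j)
    rw [MonomialOrder.coeff_mul_of_degree_add] at h2
    rcases mul_eq_zero.mp h2 with h3 | h3
    · exact hδ (MonomialOrder.lex.leadingCoeff_eq_zero_iff.mp h3)
    · exact hne (MonomialOrder.lex.leadingCoeff_eq_zero_iff.mp h3)
  intro β
  have := hco β
  rw [h0, coeff_zero] at this
  exact pow_eq_zero_iff hq.ne' |>.mp this.symm

include hsm hker hq in
theorem finrank_U [IsAlgClosed k] (hsur : Function.Surjective π) :
    Module.Finite k U ∧ Module.finrank k U = q ^ d := by
  classical
  have hli := li_good q hq π hsm hker 1 one_ne_zero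
  have hd : MonomialOrder.lex.degree (1 : MvPolynomial (Fin d) k) = 0 := by simp
  have hsp : ⊤ ≤ Submodule.span k (Set.range (fun β : {β : Fin d → Fin q //
      ∀ j, (MonomialOrder.lex.degree (1 : MvPolynomial (Fin d) k)) j + β j < q} =>
      π (1 * monomial (mb β.1) 1))) := by
    rintro u -
    obtain ⟨x, rfl⟩ := hsur u
    rw [x.as_sum, map_sum]
    apply Submodule.sum_mem
    intro β _
    by_cases hβ : ∀ j, β j < q
    · obtain ⟨a, ha⟩ := IsAlgClosed.exists_pow_nat_eq (coeff β x) hq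
      rw [← ha, ← mul_one (a ^ q), ← C_mul_monomial, hsm]
      apply Submodule.smul_mem
      apply Submodule.subset_span
      refine ⟨⟨fun j => ⟨β j, hβ j⟩, ?_⟩, ?_⟩
      · intro j; rw [hd]; simpa using hβ j
      · simp only [one_mul]
        have hmb : mb (fun j => (⟨β j, hβ j⟩ : Fin q)) = β := Finsupp.ext fun j => rfl
        rw [hmb]
    · push Not at hβ
      obtain ⟨j, hj⟩ := hβ
      have : π (monomial β (coeff β x)) = 0 := by
        rw [hker]
        refine ⟨Pi.single j (monomial (β - Finsupp.single j q) (coeff β x)), ?_⟩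
        rw [Finset.sum_eq_single j]
        · rw [Pi.single_eq_same, X_pow_eq_monomial, monomial_mul, one_mul, add_tsub_cancel_of_le]
          simpa using hj
        · intro i _ hi; simp [hi]
        · simp
      rw [this]
      exact Submodule.zero_mem _
  let b := Module.Basis.mk hli hsp
  refine ⟨Module.Finite.of_basis b, ?_⟩
  rw [Module.finrank_eq_card_basis b, Fintype.card_of_subtype Finset.univ]
  · simp
  · intro β
    simp [hd]

include hsm hker hq in
theorem finrank_ker_le [IsAlgClosed k] (hsur : Function.Surjective π)
    (δ : MvPolynomial (Fin d) k) (hδ : δ ≠ 0) (L : U →ₗ[k] U) (hL : ∀ x, L (π x) = π (δ * x)) :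
    Module.finrank k (LinearMap.ker L) * q ≤ (∑ j, (MonomialOrder.lex.degree δ) j) * q ^ d := by
  classical
  obtain ⟨hfin, hU⟩ := finrank_U q hq π hsm hker hsur
  have hli := li_good q hq π hsm hker δ hδ
  have h1 : Fintype.card {β : Fin d → Fin q //
      ∀ j, (MonomialOrder.lex.degree δ) j + β j < q} ≤ Module.finrank k (LinearMap.range L) := by
    have : LinearIndependent k (fun β : {β : Fin d → Fin q //
      ∀ j, (MonomialOrder.lex.degree δ) j + β j < q} =>
      (⟨π (δ * monomial (mb β.1) 1), ⟨π (monomial (mb β.1) 1), hL _⟩⟩ : LinearMap.range L)) := by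
      apply LinearIndependent.of_comp (LinearMap.range L).subtype
      exact hli
    exact this.fintype_card_le_finrank
  have h2 := LinearMap.finrank_range_add_finrank_ker L
  have h3 := Fintype.card_subtype_compl (fun β : Fin d → Fin q =>
      ∀ j, (MonomialOrder.lex.degree δ) j + β j < q)
  have h4 := Fintype.card_subtype_le (fun β : Fin d → Fin q =>
      ∀ j, (MonomialOrder.lex.degree δ) j + β j < q)
  have h5 : Fintype.card (Fin d → Fin q) = q ^ d := by simp
  refine le_trans (Nat.mul_le_mul_right q ?_) (card_bad q (fun j => MonomialOrder.lex.degree δ j))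
  omega
end Dim

section Rep
variable {k : Type} [Field k] {G : Type} [Group G] [Fintype G]

theorem exists_theta {d : ℕ} [Infinite k] [MulSemiringAction G (MvPolynomial (Fin d) k)]
    [SMulCommClass G k (MvPolynomial (Fin d) k)]
    (hfaithful : ∀ g : G, (∀ s : MvPolynomial (Fin d) k, g • s = s) → g = 1) :
    ∃ θ : MvPolynomial (Fin d) k, Function.Injective (fun g : G => g • θ) := by
  classical
  by_contra! hcon
  let E : G → Subspace k (MvPolynomial (Fin d) k) := fun g =>
    LinearMap.ker (DistribSMul.toLinearMap k (MvPolynomial (Fin d) k) g - LinearMap.id)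
  have hE : ∀ g s, s ∈ E g ↔ g • s = s := by
    intro g s
    simp [E, LinearMap.mem_ker, sub_eq_zero]
  have hcov : (⋃ p ∈ ((Finset.univ.erase (1 : G)).image E),
      (p : Set (MvPolynomial (Fin d) k))) = Set.univ := by
    rw [Set.eq_univ_iff_forall]
    intro θ
    have := hcon θ
    rw [Function.Injective] at this
    push Not at this
    obtain ⟨g, h, h1, h2⟩ := this
    rw [Set.mem_iUnion₂]
    refine ⟨E (h⁻¹ * g), Finset.mem_image_of_mem _ ?_, ?_⟩
    · rw [Finset.mem_erase]
      refine ⟨?_, Finset.mem_univ _⟩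
      intro h3
      rw [inv_mul_eq_one] at h3
      exact h2 h3.symm
    · change θ ∈ E _
      rw [hE, mul_smul]
      rw [h1, inv_smul_smul]
  have := Subspace.top_mem_of_biUnion_eq_univ hcov
  rw [Finset.mem_image] at this
  obtain ⟨g, hg, htop⟩ := this
  apply Finset.ne_of_mem_erase hg
  apply hfaithful
  intro s
  rw [← hE, htop]
  trivial

theorem adj_kill {S U ι : Type} [CommRing S] [AddCommGroup U] [Fintype ι] [DecidableEq ι]
    (L : S →+* AddMonoid.End U) (M : Matrix ι ι S) (u : ι → U)
    (h : ∀ i, ∑ j, L (M i j) (u j) = 0) (j : ι) : L M.det (u j) = 0 := by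
  have h1 : ∑ i, L (M.adjugate j i) (∑ l, L (M i l) (u l)) = 0 := by simp [h]
  simp only [map_sum, ← act_mul] at h1
  rw [Finset.sum_comm] at h1
  simp only [← act_sum] at h1
  have h2 : ∀ l, ∑ i, M.adjugate j i * M i l = (M.det • (1 : Matrix ι ι S)) j l := by
    intro l
    rw [← Matrix.adjugate_mul, Matrix.mul_apply]
  simp only [h2] at h1
  rw [Finset.sum_eq_single j] at h1
  · simpa using h1
  · intro l _ hl
    rw [Matrix.smul_apply, Matrix.one_apply_ne hl.symm, smul_zero, map_zero]
    rfl
  · simp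

theorem finrank_le_of_ker {E₁ E₂ X : Type} [AddCommGroup E₁] [Module k E₁] [AddCommGroup E₂]
    [Module k E₂] [AddCommGroup X] [Module k X] [Module.Finite k E₁] [Module.Finite k E₂]
    [Module.Finite k X]
    (T : E₁ →ₗ[k] E₂) (Q : LinearMap.ker T →ₗ[k] X) (hQ : Function.Injective Q) :
    Module.finrank k E₁ ≤ Module.finrank k E₂ + Module.finrank k X := by
  have h1 := LinearMap.finrank_range_add_finrank_ker T
  have h2 := Submodule.finrank_le (LinearMap.range T)
  have h3 := LinearMap.finrank_le_finrank_of_injective hQ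
  omega

/-- equivariant linear maps -/
def eqHom (k : Type) [Field k] (G : Type) [Group G] (V U : Type) [AddCommGroup V] [Module k V]
    [DistribMulAction G V] [SMulCommClass G k V] [AddCommGroup U] [Module k U]
    [DistribMulAction G U] [SMulCommClass G k U] : Submodule k (V →ₗ[k] U) where
  carrier := {f | ∀ (g : G) v, f (g • v) = g • f v}
  add_mem' := by
    intro a b ha hb g v
    rw [LinearMap.add_apply, ha, hb, LinearMap.add_apply, smul_add]
  zero_mem' := by intro g v; simp
  smul_mem' := by
    intro c f hf g v
    rw [LinearMap.smul_apply, hf, LinearMap.smul_apply, smul_comm g c]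

variable {V U S : Type} [AddCommGroup V] [Module k V]
    [DistribMulAction G V] [SMulCommClass G k V] [AddCommGroup U] [Module k U]
    [DistribMulAction G U] [SMulCommClass G k U] [Module.Finite k V] [Module.Finite k U]
    [CommRing S] [MulSemiringAction G S]
    (L : S →+* Module.End k U) (hL : ∀ (g : G) s u, g • (L s u) = L (g • s) (g • u))
    {m : ℕ} (y : Fin m → S) (eG : Fin m ≃ G)

/-- underlying additive action -/
def Ladd (L : S →+* Module.End k U) : S →+* AddMonoid.End U where
  toFun s := (L s).toAddMonoidHom
  map_one' := by rw [map_one]; rfl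
  map_mul' s t := by rw [map_mul]; rfl
  map_zero' := by rw [map_zero]; rfl
  map_add' s t := by rw [map_add]; rfl

theorem Ladd_apply (s : S) (u : U) : Ladd L s u = L s u := rfl

theorem finrank_homKer (δ : S) : Module.finrank k (V →ₗ[k] LinearMap.ker (L δ)) =
    Module.finrank k V * Module.finrank k (LinearMap.ker (L δ)) := by
  rw [Module.finrank_linearMap]

include hL in
theorem bound_upper :
    m * Module.finrank k (eqHom k G V U) ≤ Module.finrank k V * Module.finrank k U +
      m * (Module.finrank k V * Module.finrank k
        (LinearMap.ker (L (Matrix.of fun i j : Fin m => eG i • y j).det))) := by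
  set M : Matrix (Fin m) (Fin m) S := Matrix.of fun i j : Fin m => eG i • y j with hM
  let T : (Fin m → eqHom k G V U) →ₗ[k] (V →ₗ[k] U) :=
    ∑ j, (LinearMap.compRight k (L (y j))).comp
      ((eqHom k G V U).subtype.comp (LinearMap.proj j))
  have hT : ∀ f v, T f v = ∑ j, L (y j) ((f j).1 v) := by
    intro f v
    simp [T, LinearMap.sum_apply]
  have hkill : ∀ f, T f = 0 → ∀ j v, L M.det ((f j).1 v) = 0 := by
    intro f hf j v
    have := adj_kill (Ladd L) M (fun j => (f j).1 v) (by
      intro i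
      have h1 : T f ((eG i)⁻¹ • v) = 0 := by rw [hf]; rfl
      rw [hT] at h1
      have h2 := congrArg (fun z => eG i • z) h1
      simp only [Finset.smul_sum, smul_zero, hL, ← (f _).2 (eG i), smul_inv_smul] at h2
      exact h2) j
    exact this
  let Q : LinearMap.ker T →ₗ[k] (Fin m → (V →ₗ[k] LinearMap.ker (L M.det))) :=
    { toFun := fun f j => LinearMap.codRestrict _ (f.1 j).1 (fun v => hkill f.1 f.2 j v)
      map_add' := fun f g => rfl
      map_smul' := fun c f => rfl }
  have hQ : Function.Injective Q := by
    intro f g h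
    apply Subtype.ext
    funext j
    apply Subtype.ext
    ext v
    have := LinearMap.congr_fun (congrFun h j) v
    exact congrArg Subtype.val this
  have := finrank_le_of_ker T Q hQ
  rw [Module.finrank_pi_fintype, Module.finrank_pi_fintype, Module.finrank_linearMap,
    finrank_homKer] at this
  simpa using this

include hL in
theorem bound_lower :
    Module.finrank k V * Module.finrank k U ≤ m * Module.finrank k (eqHom k G V U) +
      Module.finrank k V * Module.finrank k
        (LinearMap.ker (L (Matrix.of fun i j : Fin m => eG i • y j).det)) := by
  set M : Matrix (Fin m) (Fin m) S := Matrix.of fun i j : Fin m => eG i • y j with hM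
  let T0 : Fin m → (V →ₗ[k] U) → (V →ₗ[k] U) := fun j f =>
    ∑ g : G, (DistribSMul.toLinearMap k U g).comp ((L (y j)).comp
      (f.comp (DistribSMul.toLinearMap k V g⁻¹)))
  have hT0 : ∀ j f v, T0 j f v = ∑ g : G, L (g • y j) (g • f (g⁻¹ • v)) := by
    intro j f v
    simp [T0, LinearMap.sum_apply, hL]
  let T : (V →ₗ[k] U) →ₗ[k] (Fin m → eqHom k G V U) :=
    { toFun := fun f j => ⟨T0 j f, by
        intro h v
        rw [hT0, hT0, Finset.smul_sum, ← Equiv.sum_comp (Equiv.mulLeft h)]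
        refine Finset.sum_congr rfl fun g _ => ?_
        simp only [Equiv.coe_mulLeft, mul_inv_rev, mul_smul, inv_smul_smul]
        rw [hL]⟩
      map_add' := by
        intro f g
        funext j
        apply Subtype.ext
        ext v
        simp only [Pi.add_apply, Submodule.coe_add, LinearMap.add_apply, hT0, smul_add, map_add,
          Finset.sum_add_distrib]
      map_smul' := by
        intro c f
        funext j
        apply Subtype.ext
        ext v
        simp only [Pi.smul_apply, Submodule.coe_smul, LinearMap.smul_apply, hT0, RingHom.id_apply,
          Finset.smul_sum, smul_comm _ c, map_smul] }
  have hT : ∀ f j v, (T f j).1 v = ∑ g : G, L (g • y j) (g • f (g⁻¹ • v)) := fun f j v => hT0 j f v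
  have hkill : ∀ f, T f = 0 → ∀ v, L M.det (f v) = 0 := by
    intro f hf v
    have := adj_kill (Ladd L) M.transpose (fun i => eG i • f ((eG i)⁻¹ • v)) (by
      intro j
      have h1 : (T f j).1 v = 0 := by rw [hf]; rfl
      rw [hT, ← Equiv.sum_comp eG] at h1
      exact h1) (eG.symm 1)
    rw [Matrix.det_transpose] at this
    simpa [Ladd_apply] using this
  let Q : LinearMap.ker T →ₗ[k] (V →ₗ[k] LinearMap.ker (L M.det)) :=
    { toFun := fun f => LinearMap.codRestrict _ f.1 (fun v => hkill f.1 f.2 v)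
      map_add' := fun f g => rfl
      map_smul' := fun c f => rfl }
  have hQ : Function.Injective Q := by
    intro f g h
    apply Subtype.ext
    ext v
    exact congrArg Subtype.val (LinearMap.congr_fun h v)
  have := finrank_le_of_ker T Q hQ
  rw [Module.finrank_pi_fintype, Module.finrank_linearMap, finrank_homKer] at this
  simpa using this
end Rep

section Schur
variable {k : Type} [Field k] {G : Type} [Group G] [Fintype G]

theorem irr_finite (V : Type) [AddCommGroup V] [Module k V]
    [DistribMulAction G V] [SMulCommClass G k V] (h : IsIrreducibleRep k G V) :
    Module.Finite k V := by
  obtain ⟨hn, h⟩ := h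
  obtain ⟨v, hv⟩ := exists_ne (0 : V)
  set N := Submodule.span k (Set.range fun g : G => g • v) with hN
  have hst : ∀ g : G, ∀ x ∈ N, g • x ∈ N := by
    intro g x hx
    induction hx using Submodule.span_induction with
    | mem x hx =>
      obtain ⟨h, rfl⟩ := hx
      apply Submodule.subset_span
      exact ⟨g * h, mul_smul _ _ _⟩
    | zero => rw [smul_zero]; exact Submodule.zero_mem _
    | add x y _ _ hx hy => rw [smul_add]; exact Submodule.add_mem _ hx hy
    | smul c x _ hx => rw [smul_comm]; exact Submodule.smul_mem _ _ hx
  have hvN : v ∈ N := Submodule.subset_span ⟨1, one_smul _ _⟩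
  rcases h N hst with h0 | h0
  · rw [h0, Submodule.mem_bot] at hvN
    exact absurd hvN hv
  · exact ⟨by rw [← h0]; exact Submodule.fg_span (Set.finite_range _)⟩

theorem schur_ne {V V' : Type} [AddCommGroup V] [Module k V]
    [DistribMulAction G V] [SMulCommClass G k V] [AddCommGroup V'] [Module k V']
    [DistribMulAction G V'] [SMulCommClass G k V'] (h : IsIrreducibleRep k G V)
    (h' : IsIrreducibleRep k G V') (hni : ¬ IsRepIso k G V V') (f : V →ₗ[k] V')
    (hf : ∀ (g : G) v, f (g • v) = g • f v) : f = 0 := by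
  by_contra hne
  apply hni
  have h1 := h.2 (LinearMap.ker f) (by
    intro g x hx
    rw [LinearMap.mem_ker] at hx ⊢
    rw [hf, hx, smul_zero])
  have h2 := h'.2 (LinearMap.range f) (by
    rintro g _ ⟨x, rfl⟩
    exact ⟨g • x, hf g x⟩)
  have h1 := h1.resolve_right (fun h => hne (LinearMap.ker_eq_top.mp h))
  have h2 := h2.resolve_left (fun h => hne (LinearMap.range_eq_bot.mp h))
  exact ⟨LinearEquiv.ofBijective f ⟨LinearMap.ker_eq_bot.mp h1, LinearMap.range_eq_top.mp h2⟩,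
    fun g x => hf g x⟩

theorem schur_eq [IsAlgClosed k] {V : Type} [AddCommGroup V] [Module k V]
    [DistribMulAction G V] [SMulCommClass G k V] (h : IsIrreducibleRep k G V) (f : V →ₗ[k] V)
    (hf : ∀ (g : G) v, f (g • v) = g • f v) : ∃ a : k, ∀ v, f v = a • v := by
  have := irr_finite V h
  have := h.1
  obtain ⟨a, ha⟩ := Module.End.exists_eigenvalue (K := k) f
  refine ⟨a, fun v => ?_⟩
  have h1 := h.2 (Module.End.eigenspace f a) (by
    intro g x hx
    rw [Module.End.mem_eigenspace_iff] at hx ⊢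
    rw [hf, hx, smul_comm])
  have h2 := h1.resolve_left ha
  rw [← Module.End.mem_eigenspace_iff, h2]
  trivial

theorem finrank_eqHom [IsAlgClosed k] {n : ℕ} (W : Fin (n + 1) → Type)
    [∀ i, AddCommGroup (W i)] [∀ i, Module k (W i)]
    [∀ i, DistribMulAction G (W i)] [∀ i, SMulCommClass G k (W i)]
    (hirr : ∀ i, IsIrreducibleRep k G (W i))
    (hdist : ∀ i j, i ≠ j → ¬ IsRepIso k G (W i) (W j)) (c : Fin (n + 1) → ℕ) (i : Fin (n + 1)) :
    Module.finrank k (eqHom k G (W i) (∀ i : Fin (n + 1), Fin (c i) → W i)) = c i := by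
  have := (hirr i).1
  let Θ : (Fin (c i) → k) →ₗ[k] (eqHom k G (W i) (∀ i : Fin (n + 1), Fin (c i) → W i)) :=
    { toFun := fun l => ⟨(LinearMap.single k (fun i => Fin (c i) → W i) i).comp
        (LinearMap.pi fun t => l t • LinearMap.id), by
          intro g v
          funext j
          by_cases hj : j = i
          · subst hj
            funext t
            simp [smul_comm]
          · funext t
            simp [hj]⟩
      map_add' := by
        intro l l'
        apply Subtype.ext
        ext v j t
        by_cases hj : j = i
        · subst hj
          simp [add_smul]
        · simp [hj]
      map_smul' := by
        intro a l
        apply Subtype.ext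
        ext v j t
        by_cases hj : j = i
        · subst hj
          simp [mul_smul]
        · simp [hj] }
  have hΘ : ∀ l v t, (Θ l).1 v i t = l t • v := by
    intro l v t
    simp [Θ]
  have hΘ' : ∀ l v j t, j ≠ i → (Θ l).1 v j t = 0 := by
    intro l v j t hj
    simp [Θ, hj]
  have hbij : Function.Bijective Θ := by
    constructor
    · intro l l' h
      obtain ⟨v, hv⟩ := exists_ne (0 : W i)
      funext t
      have h1 : (Θ l).1 v i t = (Θ l').1 v i t := by rw [h]
      rw [hΘ, hΘ] at h1
      exact smul_left_injective k hv h1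
    · intro f
      have h1 : ∀ t, ∃ a : k, ∀ v, f.1 v i t = a • v := by
        intro t
        exact schur_eq (hirr i) (((LinearMap.proj t).comp (LinearMap.proj i)).comp f.1)
          (fun g v => congrFun (congrFun (f.2 g v) i) t)
      choose l hl using h1
      refine ⟨l, ?_⟩
      apply Subtype.ext
      ext v j t
      by_cases hj : j = i
      · subst hj
        rw [hΘ, hl]
      · rw [hΘ' _ _ _ _ hj]
        have := schur_ne (hirr i) (hirr j) (hdist i j (Ne.symm hj))
          (((LinearMap.proj t).comp (LinearMap.proj j)).comp f.1)
          (fun g v => congrFun (congrFun (f.2 g v) j) t)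
        exact (LinearMap.congr_fun this v).symm
  rw [← (LinearEquiv.ofBijective Θ hbij).finrank_eq]
  simp
end Schur

section Fin

theorem exists_L {k : Type} [Field k] {d : ℕ} {G : Type} [Group G]
    [MulSemiringAction G (MvPolynomial (Fin d) k)]
    {U : Type} [AddCommGroup U] [Module k U] [DistribMulAction G U] (q : ℕ)
    (π : MvPolynomial (Fin d) k →+ U) (hsur : Function.Surjective π)
    (hsm : ∀ (a : k) x, π (C (a ^ q) * x) = a • π x)
    (hg : ∀ (g : G) x, π (g • x) = g • π x)
    (hker : ∀ x, π x = 0 ↔ ∃ z : Fin d → MvPolynomial (Fin d) k, x = ∑ j, X j ^ q * z j) :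
    ∃ L : MvPolynomial (Fin d) k →+* Module.End k U, (∀ s x, L s (π x) = π (s * x)) ∧
      ∀ (g : G) s u, g • (L s u) = L (g • s) (g • u) := by
  have hwd : ∀ s x x', π x = π x' → π (s * x) = π (s * x') := by
    intro s x x' h
    rw [← sub_eq_zero, ← map_sub] at h ⊢
    rw [hker] at h
    obtain ⟨z, hz⟩ := h
    rw [hker]
    refine ⟨fun j => s * z j, ?_⟩
    rw [← mul_sub, hz, Finset.mul_sum]
    exact Finset.sum_congr rfl fun j _ => by ring
  let f : MvPolynomial (Fin d) k → U → U := fun s u => π (s * Function.surjInv hsur u)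
  have hf : ∀ s x, f s (π x) = π (s * x) := fun s x =>
    hwd s _ _ (Function.surjInv_eq hsur (π x))
  let L : MvPolynomial (Fin d) k →+* Module.End k U :=
    { toFun := fun s =>
        { toFun := f s
          map_add' := by
            intro u v
            obtain ⟨x, rfl⟩ := hsur u
            obtain ⟨y, rfl⟩ := hsur v
            rw [← map_add, hf, hf, hf, mul_add, map_add]
          map_smul' := by
            intro a u
            obtain ⟨x, rfl⟩ := hsur u
            rw [← hsm, hf, hf, RingHom.id_apply, ← hsm]
            congr 1
            ring }
      map_one' := by
        ext u
        obtain ⟨x, rfl⟩ := hsur u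
        change f _ _ = _
        rw [hf, one_mul]; rfl
      map_mul' := by
        intro s t
        ext u
        obtain ⟨x, rfl⟩ := hsur u
        change f _ _ = f s (f t _)
        rw [hf (s * t) x, hf t x, hf s (t * x), mul_assoc]
      map_zero' := by
        ext u
        obtain ⟨x, rfl⟩ := hsur u
        change f _ _ = 0
        rw [hf, zero_mul, map_zero]
      map_add' := by
        intro s t
        ext u
        obtain ⟨x, rfl⟩ := hsur u
        change f _ _ = f s _ + f t _
        rw [hf, hf, hf, add_mul, map_add] }
  have hL : ∀ s x, L s (π x) = π (s * x) := hf
  refine ⟨L, hL, ?_⟩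
  intro g s u
  obtain ⟨x, rfl⟩ := hsur u
  rw [hL, ← hg, ← hg, hL, smul_mul']

theorem tendsto_of_bounds (p d m D a : ℕ) (hp : 1 < p) (hm : 0 < m) (c : ℕ → ℕ)
    (h : ∀ e, 1 ≤ e → ∃ B, B * p ^ e ≤ D * (p ^ e) ^ d ∧
      m * c e ≤ a * (p ^ e) ^ d + m * (a * B) ∧ a * (p ^ e) ^ d ≤ m * c e + a * B) :
    Filter.Tendsto (fun e : ℕ => (c e : ℝ) / (p : ℝ) ^ (d * e)) Filter.atTop
      (nhds ((a : ℝ) / (m : ℝ))) := by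
  have hp0 : (0 : ℝ) < p := by exact_mod_cast (by omega : 0 < p)
  have hm0 : (0 : ℝ) < m := by exact_mod_cast hm
  have hm1 : (1 : ℝ) ≤ m := by exact_mod_cast hm
  have hlim : Filter.Tendsto (fun e : ℕ => (a * D : ℝ) * ((p : ℝ)⁻¹) ^ e) Filter.atTop
      (nhds 0) := by
    have := tendsto_pow_atTop_nhds_zero_of_lt_one (r := (p : ℝ)⁻¹) (by positivity)
      (inv_lt_one_of_one_lt₀ (by exact_mod_cast hp))
    simpa using this.const_mul (a * D : ℝ)
  rw [tendsto_iff_dist_tendsto_zero]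
  refine squeeze_zero' (Filter.Eventually.of_forall fun _ => dist_nonneg) ?_ hlim
  filter_upwards [Filter.eventually_ge_atTop 1] with e he
  obtain ⟨B, h1, h2, h3⟩ := h e he
  have h1 : (B : ℝ) * p ^ e ≤ D * (p ^ e) ^ d := by exact_mod_cast h1
  have h2 : (m : ℝ) * c e ≤ a * (p ^ e) ^ d + m * (a * B) := by exact_mod_cast h2
  have h3 : (a : ℝ) * (p ^ e) ^ d ≤ m * c e + a * B := by exact_mod_cast h3
  have hN : (p : ℝ) ^ (d * e) = (p ^ e) ^ d := by rw [← pow_mul, mul_comm]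
  rw [hN, inv_pow]
  have hq0 : (0 : ℝ) < p ^ e := by positivity
  generalize (p : ℝ) ^ e = q at *
  have hQ : (0 : ℝ) < q ^ d := by positivity
  generalize q ^ d = N at *
  have ha : (0 : ℝ) ≤ a := Nat.cast_nonneg _
  have hB : (0 : ℝ) ≤ B := Nat.cast_nonneg _
  have h4 : (c e : ℝ) / N - a / m = (m * c e - a * N) / (m * N) := by
    field_simp
  have h5 : (B : ℝ) / N ≤ D / q := by
    rw [div_le_div_iff₀ hQ hq0]
    exact h1
  rw [Real.dist_eq, h4, abs_div, abs_of_pos (mul_pos hm0 hQ)]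
  have h6 : |(m : ℝ) * c e - a * N| ≤ m * (a * B) := by
    have : (a : ℝ) * B ≤ m * (a * B) := le_mul_of_one_le_left (by positivity) hm1
    rw [abs_le]
    constructor <;> linarith
  calc |(m : ℝ) * c e - a * N| / (m * N) ≤ (m * (a * B)) / (m * N) := by gcongr
    _ = a * (B / N) := by field_simp
    _ ≤ a * (D / q) := by gcongr
    _ = a * D * q⁻¹ := by ring
end Fin

theorem generalized_F_signature_of_invariant_subrings
    (k : Type) [Field k] [IsAlgClosed k] (p : ℕ) [Fact p.Prime] [CharP k p]
    (d n : ℕ) (G : Type) [Group G] [Fintype G]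
    [MulSemiringAction G (MvPolynomial (Fin d) k)]
    [SMulCommClass G k (MvPolynomial (Fin d) k)]
    -- the order of `G` is not divisible by `p`
    (hord : ¬ p ∣ Fintype.card G)
    -- the action of `G` on `S` is induced by a linear action on `V = ⟨x_1, …, x_d⟩`
    (hlin : ∀ (g : G) (j : Fin d),
      g • (X j : MvPolynomial (Fin d) k) ∈ Submodule.span k (Set.range X))
    -- `G ⊆ GL(V)`: the action is faithful
    (hfaithful : ∀ g : G, (∀ s : MvPolynomial (Fin d) k, g • s = s) → g = 1)
    -- `G` contains no pseudo-reflections: for `g ≠ 1`, `rank (g - 1)|_V ≠ 1`, where the image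
    -- of `(g - 1)|_V` is spanned by the elements `g • x_j - x_j`
    (hps : ∀ g : G, g ≠ 1 → Module.finrank k
      (Submodule.span k (Set.range fun j : Fin d =>
        g • (X j : MvPolynomial (Fin d) k) - X j)) ≠ 1)
    -- `V_0 = k, V_1, …, V_n`: a complete set of pairwise non-isomorphic irreducible
    -- representations of `G` over `k`, with `V_0` the trivial one-dimensional representation
    (W : Fin (n + 1) → Type) [∀ i, AddCommGroup (W i)] [∀ i, Module k (W i)]
    [∀ i, DistribMulAction G (W i)] [∀ i, SMulCommClass G k (W i)]
    (hirr : ∀ i, IsIrreducibleRep k G (W i))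
    (hdist : ∀ i j, i ≠ j → ¬ IsRepIso k G (W i) (W j))
    (hcomplete : ∀ (P : Type) [AddCommGroup P] [Module k P] [DistribMulAction G P]
      [SMulCommClass G k P], IsIrreducibleRep k G P → ∃ i, IsRepIso k G P (W i))
    (htriv : Module.finrank k (W 0) = 1 ∧ ∀ (g : G) (x : W 0), g • x = x)
    -- `c` gives the multiplicities of a decomposition `ᵉR ≅ ⊕_i M_i^{⊕ c e i}` as `R`-modules,
    -- where `ᵉR` is `R` with the `R`-action `r · x = r^{p^e} x`
    (c : ℕ → Fin (n + 1) → ℕ)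
    (hc : ∀ e : ℕ, 1 ≤ e →
      ∃ φ : invariantSubalgebra k d G ≃+
        (∀ i : Fin (n + 1), Fin (c e i) → invariantsTensor k d G (W i)),
      ∀ (r x : invariantSubalgebra k d G), φ (r ^ p ^ e * x) = r • φ x) :
    -- conclusion: `c e i / p^{d e}` converges to `dim_k V_i / |G|`
    ∀ i : Fin (n + 1), Filter.Tendsto
      (fun e : ℕ => (c e i : ℝ) / (p : ℝ) ^ (d * e)) Filter.atTop
      (nhds ((Module.finrank k (W i) : ℝ) / (Fintype.card G : ℝ))) := by
  intro i
  have : Infinite k := IsAlgClosed.instInfinite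
  obtain ⟨θ, hθ⟩ := exists_theta (k := k) (G := G) hfaithful
  set m := Fintype.card G with hm
  let eG : Fin m ≃ G := (Fintype.equivFin G).symm
  let y : Fin m → MvPolynomial (Fin d) k := fun j => θ ^ (j : ℕ)
  set δ : MvPolynomial (Fin d) k := (Matrix.of fun i j : Fin m => eG i • y j).det with hδdef
  have hδ : δ ≠ 0 := by
    have h1 : (Matrix.of fun i j : Fin m => eG i • y j) =
        Matrix.vandermonde (fun i => eG i • θ) := by
      ext1 i j
      simp only [Matrix.of_apply, Matrix.vandermonde_apply, y, smul_pow']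
    rw [hδdef, h1, Matrix.det_vandermonde_ne_zero_iff]
    exact hθ.comp eG.injective
  have hp : 1 < p := (Fact.out : p.Prime).one_lt
  refine tendsto_of_bounds p d m (∑ j, (MonomialOrder.lex.degree δ) j)
    (Module.finrank k (W i)) hp Fintype.card_pos (fun e => c e i) ?_
  intro e he
  obtain ⟨φ, hφ⟩ := hc e he
  obtain ⟨π, hsur, hsm, hg, hker⟩ := lift_main k d n G W (c e) p hlin hfaithful hps e φ hφ
  have hq : 0 < p ^ e := by positivity
  obtain ⟨L, hL, hLg⟩ := exists_L (G := G) (p ^ e) π hsur hsm hg hker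
  obtain ⟨hfin, hU⟩ := finrank_U (p ^ e) hq π hsm hker hsur
  have := irr_finite (W i) (hirr i)
  refine ⟨Module.finrank k (LinearMap.ker (L δ)), ?_, ?_, ?_⟩
  · exact finrank_ker_le (p ^ e) hq π hsm hker hsur δ hδ (L δ) (hL δ)
  · have h1 := bound_upper (V := W i) L hLg y eG
    rw [finrank_eqHom W hirr hdist (c e) i, hU] at h1
    exact h1
  · have h1 := bound_lower (V := W i) L hLg y eG
    rw [finrank_eqHom W hirr hdist (c e) i, hU] at h1
    exact h1
end

section
/- For every i ∈ {0,…,n}, the sequence e ↦ dim_k Hom_{kG}(V_i, S/𝔪^{[p^e]}) / p^{de} converges as e → ∞, with limit (dim_k V_i)/|G|. Here S/𝔪^{[p^e]} is a kG-module via the induced G-action on S. -/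
/-!
Setting: `k` algebraically closed field of characteristic `p > 0`, `S = k[x_1, …, x_d]`,
`G ⊆ GL(V)` a finite group (acting faithfully on `S` by `k`-algebra automorphisms induced by a
linear action on `V = ⟨x_1, …, x_d⟩`) with `p ∤ |G|`; `V_0 = k, V_1, …, V_n` a complete set of
pairwise non-isomorphic irreducible `kG`-modules.  Claim:
`dim_k Hom_{kG}(V_i, S/𝔪^{[p^e]}) / p^{de}  →  dim_k V_i / |G|` as `e → ∞`.
-/

set_option linter.unusedSectionVars false
set_option synthInstance.maxHeartbeats 1000000
set_option maxHeartbeats 1600000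

open MvPolynomial TensorProduct

section Defs

variable (k : Type) [Field k] (p d : ℕ) [Fact p.Prime] [CharP k p]
variable (G : Type) [Group G] [Fintype G]
variable [MulSemiringAction G (MvPolynomial (Fin d) k)]
variable [SMulCommClass G k (MvPolynomial (Fin d) k)]

/-- The Frobenius power `𝔪^{[q]} = (x_1^q, …, x_d^q)` with `q = p^e`. -/
noncomputable def frobPowIdeal (e : ℕ) : Ideal (MvPolynomial (Fin d) k) :=
  Ideal.span (Set.range fun j : Fin d => (X j : MvPolynomial (Fin d) k) ^ p ^ e)

theorem pow_mem_frobPowIdeal (e : ℕ) (v : MvPolynomial (Fin d) k)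
    (hv : v ∈ Submodule.span k (Set.range X)) :
    v ^ p ^ e ∈ frobPowIdeal k p d e := by
  induction hv using Submodule.span_induction with
  | mem x hx =>
      obtain ⟨j, rfl⟩ := hx
      exact Ideal.subset_span ⟨j, rfl⟩
  | zero =>
      rw [zero_pow (pow_ne_zero e (Fact.out : p.Prime).ne_zero)]
      exact zero_mem _
  | add x y _ _ hx hy =>
      rw [add_pow_char_pow]
      exact add_mem hx hy
  | smul c x _ hx =>
      rw [smul_pow, MvPolynomial.smul_eq_C_mul]
      exact Ideal.mul_mem_left _ _ hx

theorem smul_mem_frobPowIdeal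
    (hlin : ∀ (g : G) (j : Fin d),
      g • (X j : MvPolynomial (Fin d) k) ∈ Submodule.span k (Set.range X))
    (e : ℕ) (g : G) (x : MvPolynomial (Fin d) k) (hx : x ∈ frobPowIdeal k p d e) :
    g • x ∈ frobPowIdeal k p d e := by
  have : g • x = MulSemiringAction.toRingHom G (MvPolynomial (Fin d) k) g x := rfl
  rw [this]
  have h2 : Ideal.map (MulSemiringAction.toRingHom G (MvPolynomial (Fin d) k) g)
      (frobPowIdeal k p d e) ≤ frobPowIdeal k p d e := by
    rw [frobPowIdeal, Ideal.map_span]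
    apply Ideal.span_le.2
    rintro y ⟨z, ⟨j, rfl⟩, rfl⟩
    simp only [map_pow]
    exact pow_mem_frobPowIdeal k p d e _ (hlin g j)
  exact h2 (Ideal.mem_map_of_mem _ hx)

/-- `S/𝔪^{[q]}` as a `k`-vector space. -/
def frobQuot (e : ℕ) : Type :=
  MvPolynomial (Fin d) k ⧸ (Submodule.restrictScalars k (frobPowIdeal k p d e))

noncomputable instance (e : ℕ) : AddCommGroup (frobQuot k p d e) :=
  inferInstanceAs (AddCommGroup (MvPolynomial (Fin d) k ⧸
    (Submodule.restrictScalars k (frobPowIdeal k p d e))))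

noncomputable instance (e : ℕ) : Module k (frobQuot k p d e) :=
  inferInstanceAs (Module k (MvPolynomial (Fin d) k ⧸
    (Submodule.restrictScalars k (frobPowIdeal k p d e))))

/-- The `k`-linear endomorphism of `S/𝔪^{[q]}` induced by the action of `g ∈ G`. -/
noncomputable def frobQuotAction
    (hlin : ∀ (g : G) (j : Fin d),
      g • (X j : MvPolynomial (Fin d) k) ∈ Submodule.span k (Set.range X))
    (e : ℕ) (g : G) : frobQuot k p d e →ₗ[k] frobQuot k p d e :=
  Submodule.mapQ _ _ (DistribMulAction.toLinearMap k _ g)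
    (fun x hx => smul_mem_frobPowIdeal k p d G hlin e g x hx)

variable (W : Type) [AddCommGroup W] [Module k W] [DistribMulAction G W] [SMulCommClass G k W]

/-- `Hom_{kG}(W, S/𝔪^{[p^e]})`: the space of `G`-equivariant `k`-linear maps. -/
def equivariantHom
    (hlin : ∀ (g : G) (j : Fin d),
      g • (X j : MvPolynomial (Fin d) k) ∈ Submodule.span k (Set.range X))
    (e : ℕ) : Submodule k (W →ₗ[k] frobQuot k p d e) where
  carrier := {f | ∀ (g : G) (w : W), f (g • w) = frobQuotAction k p d G hlin e g (f w)}
  add_mem' := by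
    intro f f' hf hf' g w
    simp [hf g w, hf' g w]
  zero_mem' := by intro g w; simp
  smul_mem' := by
    intro c f hf g w
    simp [hf g w]

end Defs

section Abs
variable {k S G W M : Type} [Field k] [CommRing S] [Algebra k S] [Group G] [Fintype G]
  [MulSemiringAction G S] [AddCommGroup W] [Module k W] [DistribMulAction G W]
  [SMulCommClass G k W] [AddCommGroup M] [Module k M] [Module S M] [IsScalarTower k S M]

/-- the Dedekind matrix -/
def dedMat (b : G → S) : Matrix G G S := Matrix.of fun g i => g • b i

theorem finrank_hom_ker_le [Module.Finite k W] [Module.Finite k M] (δ : S) {ι : Type} [Fintype ι]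
    (U : Type) [AddCommGroup U] [Module k U] (j : U →ₗ[k] (ι → (W →ₗ[k] M)))
    (hj : Function.Injective j) (h : ∀ u i w, δ • j u i w = 0) :
    Module.finrank k U ≤ Fintype.card ι *
      (Module.finrank k W * Module.finrank k (LinearMap.ker (Algebra.lsmul k k M δ))) := by
  let K := LinearMap.ker (Algebra.lsmul k k M δ)
  let J : U →ₗ[k] (ι → (W →ₗ[k] K)) :=
    { toFun := fun u i => LinearMap.codRestrict K (j u i) (fun w => by
        simpa [K] using h u i w)
      map_add' := by intro x y; ext i w; simp
      map_smul' := by intro x y; ext i w; simp }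
  have hJ : Function.Injective J := by
    intro x y hxy
    apply hj
    ext i w
    have := congrArg (fun F => ((F i w : K) : M)) hxy
    simpa [J] using this
  have := LinearMap.finrank_le_finrank_of_injective hJ
  simpa [Module.finrank_pi_fintype, Module.finrank_linearMap] using this

variable (ρ : G → M →ₗ[k] M) (E : Submodule k (W →ₗ[k] M))

theorem upper_bound [Module.Finite k W] [Module.Finite k M] [DecidableEq G]
    (h1 : ∀ m, ρ 1 m = m) (hmul : ∀ g h m, ρ (g * h) m = ρ g (ρ h m))
    (hs : ∀ g (s : S) m, ρ g (s • m) = (g • s) • ρ g m)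
    (hE : ∀ f, f ∈ E ↔ ∀ g w, f (g • w) = ρ g (f w)) (b : G → S) :
    Fintype.card G * Module.finrank k E ≤ Module.finrank k W * Module.finrank k M +
      Fintype.card G * (Module.finrank k W * Module.finrank k
        (LinearMap.ker (Algebra.lsmul k k M (dedMat b).det))) := by
  let α : (G → E) →ₗ[k] (W →ₗ[k] M) :=
    { toFun := fun f => ∑ i, (Algebra.lsmul k k M (b i)) ∘ₗ (f i : W →ₗ[k] M)
      map_add' := by
        intro x y; ext w; simp [LinearMap.sum_apply, Finset.sum_add_distrib]
      map_smul' := by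
        intro x y; ext w
        simp [LinearMap.sum_apply, Finset.smul_sum, smul_comm x] }
  have hα : ∀ f w, α f w = ∑ i, b i • (f i : W →ₗ[k] M) w := by
    intro f w; simp [α, LinearMap.sum_apply]
  have hr := LinearMap.finrank_range_add_finrank_ker α
  have h2 : Module.finrank k (LinearMap.range α) ≤ Module.finrank k W * Module.finrank k M := by
    rw [← Module.finrank_linearMap k k]
    exact Submodule.finrank_le _
  have h3 := finrank_hom_ker_le (k := k) (W := W) (M := M) (dedMat b).det (ι := G) (LinearMap.ker α)
    ({ toFun := fun f i => (f.1 i : W →ₗ[k] M)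
       map_add' := by intro x y; ext; simp
       map_smul' := by intro x y; ext; simp })
    (by
      intro x y hxy
      ext i w
      have := congrArg (fun F => F i w) hxy
      simpa using this)
    (by
      rintro ⟨f, hf⟩ i w
      show (dedMat b).det • (f i : W →ₗ[k] M) w = 0
      have key : ∀ g : G, ∑ j, (g • b j) • (f j : W →ₗ[k] M) w = 0 := by
        intro g
        have e1 : α f (g⁻¹ • w) = 0 := by rw [LinearMap.mem_ker.1 hf]; rfl
        rw [hα] at e1
        have e2 := congrArg (ρ g) e1
        rw [map_sum, map_zero] at e2
        rw [← e2]
        refine Finset.sum_congr rfl fun j _ => ?_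
        rw [hs, ← (hE _).1 (f j).2, smul_inv_smul]
      have e3 : ∑ g, (dedMat b).adjugate i g • ∑ j, (g • b j) • (f j : W →ₗ[k] M) w = 0 := by
        simp [key]
      simp_rw [Finset.smul_sum, smul_smul] at e3
      rw [Finset.sum_comm] at e3
      simp_rw [← Finset.sum_smul] at e3
      have e4 : ∀ j, ∑ g, (dedMat b).adjugate i g * (g • b j) = 
          ((dedMat b).det • (1 : Matrix G G S)) i j := by
        intro j; rw [← Matrix.adjugate_mul, Matrix.mul_apply]; rfl
      simp_rw [e4] at e3
      simpa [Matrix.one_apply, ite_smul] using e3)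
  rw [Module.finrank_pi_fintype, Finset.sum_const, Finset.card_univ, smul_eq_mul] at hr
  omega

theorem lower_bound [Module.Finite k W] [Module.Finite k M] [DecidableEq G]
    (h1 : ∀ m, ρ 1 m = m) (hmul : ∀ g h m, ρ (g * h) m = ρ g (ρ h m))
    (hs : ∀ g (s : S) m, ρ g (s • m) = (g • s) • ρ g m)
    (hE : ∀ f, f ∈ E ↔ ∀ g w, f (g • w) = ρ g (f w)) (b : G → S) :
    Module.finrank k W * Module.finrank k M ≤ Fintype.card G * Module.finrank k E + 
      (Module.finrank k W * Module.finrank k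
        (LinearMap.ker (Algebra.lsmul k k M (dedMat b).det))) := by
  let T : G → (W →ₗ[k] M) → (W →ₗ[k] M) := fun i φ =>
    ∑ g, ρ g ∘ₗ (Algebra.lsmul k k M (b i)) ∘ₗ φ ∘ₗ DistribSMul.toLinearMap k W g⁻¹
  have hT : ∀ i φ w, T i φ w = ∑ g, (g • b i) • ρ g (φ (g⁻¹ • w)) := by
    intro i φ w; simp [T, LinearMap.sum_apply, hs]
  have hTE : ∀ i φ, T i φ ∈ E := by
    intro i φ
    rw [hE]
    intro g w
    rw [hT, hT, map_sum, ← Equiv.sum_comp (Equiv.mulLeft g)]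
    refine Finset.sum_congr rfl fun h _ => ?_
    simp [hs, hmul, mul_smul]
  let β : (W →ₗ[k] M) →ₗ[k] (G → E) :=
    { toFun := fun φ i => ⟨T i φ, hTE i φ⟩
      map_add' := by
        intro x y; ext i w; simp [hT, Finset.sum_add_distrib]
      map_smul' := by
        intro x y; ext i w
        simp [hT, Finset.smul_sum, smul_comm x] }
  have hr := LinearMap.finrank_range_add_finrank_ker β
  have h2 : Module.finrank k (LinearMap.range β) ≤ Fintype.card G * Module.finrank k E := by
    have : Module.finrank k (G → E) = Fintype.card G * Module.finrank k E := by
      rw [Module.finrank_pi_fintype, Finset.sum_const, Finset.card_univ, smul_eq_mul]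
    rw [← this]
    exact Submodule.finrank_le _
  have h3 := finrank_hom_ker_le (k := k) (W := W) (M := M) (dedMat b).det (ι := Unit) (LinearMap.ker β)
    ({ toFun := fun f i => f.1
       map_add' := by intro x y; ext; simp
       map_smul' := by intro x y; ext; simp })
    (by
      intro x y hxy
      ext w
      have := congrArg (fun F => F () w) hxy
      simpa using this)
    (by
      rintro ⟨φ, hf⟩ _ w
      show (dedMat b).det • φ w = 0
      have key : ∀ i, ∑ g, (g • b i) • ρ g (φ (g⁻¹ • w)) = 0 := by
        intro i
        rw [← hT]
        have := congrArg (fun F => ((F i : E) : W →ₗ[k] M) w) (LinearMap.mem_ker.1 hf)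
        simpa [β] using this
      have e3 : ∑ i, (dedMat b).adjugate i 1 • ∑ g, (g • b i) • ρ g (φ (g⁻¹ • w)) = 0 := by
        simp [key]
      simp_rw [Finset.smul_sum, smul_smul] at e3
      rw [Finset.sum_comm] at e3
      simp_rw [← Finset.sum_smul] at e3
      have e4 : ∀ g, ∑ i, (dedMat b).adjugate i 1 * (g • b i) = 
          ((dedMat b).det • (1 : Matrix G G S)) g 1 := by
        intro j; rw [← Matrix.mul_adjugate, Matrix.mul_apply]
        exact Finset.sum_congr rfl fun _ _ => mul_comm _ _
      simp_rw [e4] at e3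
      simpa [Matrix.one_apply, ite_smul, h1] using e3)
  rw [Module.finrank_linearMap] at hr
  simp only [Fintype.card_unit, one_mul] at h3
  omega

theorem exists_dedMat_det_ne_zero [IsDomain S] [DecidableEq G]
    (hf : ∀ g : G, (∀ s : S, g • s = s) → g = 1) : ∃ b : G → S, (dedMat b).det ≠ 0 := by
  let L := FractionRing S
  let F : G → (S →* L) := fun g =>
    ((algebraMap S L).comp (MulSemiringAction.toRingHom G S g) : S →+* L)
  have hF : ∀ g s, F g s = algebraMap S L (g • s) := fun _ _ => rfl
  have inj : Function.Injective F := by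
    intro g h hgh
    have : ∀ s : S, g • s = h • s := fun s => by
      have := DFunLike.congr_fun hgh s
      rw [hF, hF] at this
      exact IsFractionRing.injective S L this
    have := hf (h⁻¹ * g) (fun s => by rw [mul_smul, this, inv_smul_smul])
    exact (inv_mul_eq_one.1 this).symm
  have li : LinearIndependent L (fun g => (F g : S → L)) :=
    (linearIndependent_monoidHom S L).comp F inj
  let v : S → (G → L) := fun s g => F g s
  have htop : Submodule.span L (Set.range v) = ⊤ := by
    by_contra hne
    obtain ⟨φ, hφ, hle⟩ := Submodule.exists_le_ker_of_lt_top _ (lt_top_iff_ne_top.2 hne)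
    apply hφ
    have hz : ∀ s, ∑ g, φ (Pi.single g 1) * F g s = 0 := by
      intro s
      have : φ (v s) = 0 := hle (Submodule.subset_span ⟨s, rfl⟩)
      rw [← this, LinearMap.pi_apply_eq_sum_univ φ (v s)]
      refine Finset.sum_congr rfl fun g _ => ?_
      rw [smul_eq_mul, mul_comm]
      congr 2
      ext i; simp [Pi.single_apply, eq_comm]
    have h0 := Fintype.linearIndependent_iff.1 li (fun g => φ (Pi.single g 1)) (by
      ext s; simpa using hz s)
    apply LinearMap.pi_ext'
    intro g
    ext
    simpa using h0 g
  obtain ⟨t, htr, hts, hti⟩ := exists_linearIndependent L (Set.range v)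
  rw [htop] at hts
  let B := Module.Basis.mk hti (by rw [Subtype.range_coe, hts])
  have e : t ≃ G := by
    have := B.indexEquiv (Pi.basisFun L G)
    exact this
  have hch : ∀ g : G, ∃ s, v s = (e.symm g : G → L) := fun g => htr (e.symm g).2
  choose b hb using hch
  refine ⟨b, fun hdet => ?_⟩
  have hli : LinearIndependent L (fun g : G => v (b g)) := by
    have h1 : (fun g : G => v (b g)) = Subtype.val ∘ e.symm := funext hb
    rw [h1]
    exact hti.comp e.symm e.symm.injective
  have hu : IsUnit (Matrix.of (fun g => v (b g))) := by
    rw [← Matrix.linearIndependent_rows_iff_isUnit]; exact hli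
  rw [Matrix.isUnit_iff_isUnit_det] at hu
  apply hu.ne_zero
  have : Matrix.of (fun g => v (b g)) = ((algebraMap S L).mapMatrix (dedMat b)).transpose := by
    ext i j; simp [v, hF, dedMat]
  rw [this, Matrix.det_transpose, ← RingHom.map_det, hdet, map_zero]
end Abs

section Box
variable {k : Type} [Field k] {d : ℕ}

/-- exponent vector -/
noncomputable def boxExp {n : Fin d → ℕ} (c : ∀ j, Fin (n j)) : Fin d →₀ ℕ :=
  Finsupp.equivFunOnFinite.symm fun j => (c j : ℕ)

theorem boxExp_apply {n : Fin d → ℕ} (c : ∀ j, Fin (n j)) (j : Fin d) :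
    boxExp c j = c j := rfl

theorem boxExp_inj {n : Fin d → ℕ} : Function.Injective (boxExp (n := n)) := by
  intro c c' h
  ext j
  rw [← boxExp_apply, h, boxExp_apply]

/-- polynomial with given coefficients in a box -/
noncomputable def boxPoly (n : Fin d → ℕ) :
    ((∀ j, Fin (n j)) → k) →ₗ[k] MvPolynomial (Fin d) k :=
  ∑ c, (monomial (boxExp c)) ∘ₗ LinearMap.proj c

theorem coeff_boxPoly (n : Fin d → ℕ) (v : (∀ j, Fin (n j)) → k) (a : Fin d →₀ ℕ) :
    coeff a (boxPoly n v) = ∑ c, if boxExp c = a then v c else 0 := by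
  simp [boxPoly, LinearMap.sum_apply, coeff_sum, coeff_monomial]

theorem coeff_boxPoly_boxExp (n : Fin d → ℕ) (v : (∀ j, Fin (n j)) → k) (c) :
    coeff (boxExp c) (boxPoly n v) = v c := by
  simp [coeff_boxPoly, boxExp_inj.eq_iff]

theorem lt_of_coeff_boxPoly (n : Fin d → ℕ) (v : (∀ j, Fin (n j)) → k) (a : Fin d →₀ ℕ)
    (h : coeff a (boxPoly n v) ≠ 0) (j : Fin d) : a j < n j := by
  rw [coeff_boxPoly] at h
  obtain ⟨c, _, hc⟩ := Finset.exists_ne_zero_of_sum_ne_zero h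
  have : boxExp c = a := by
    by_contra h; simp [h] at hc
  rw [← this]; exact (c j).2

theorem mem_frobPowIdeal_iff (p e : ℕ) (f : MvPolynomial (Fin d) k) :
    f ∈ frobPowIdeal k p d e ↔ ∀ a, coeff a f ≠ 0 → ∃ j, p ^ e ≤ a j := by
  have := @mem_ideal_span_monomial_image (Fin d) k _ f
    (Set.range fun j => Finsupp.single j (p ^ e))
  rw [← Set.range_comp] at this
  have h2 : frobPowIdeal k p d e = Ideal.span (Set.range
    ((fun s => monomial s (1 : k)) ∘ fun j => Finsupp.single j (p ^ e))) := by
    rw [frobPowIdeal]; congr 2; ext1 j; simp [X_pow_eq_monomial]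
  rw [h2, this]
  simp [mem_support_iff]

/-- the equivalence of the quotient with functions on the box -/
noncomputable def frobQuotEquiv (p e : ℕ) :
    frobQuot k p d e ≃ₗ[k] ((Fin d → Fin (p ^ e)) → k) := by
  let Γ : MvPolynomial (Fin d) k →ₗ[k] ((∀ _ : Fin d, Fin (p ^ e)) → k) :=
    LinearMap.pi fun c => lcoeff k (boxExp (n := fun _ => p ^ e) c)
  have hΓ : ∀ f c, Γ f c = coeff (boxExp (n := fun _ => p ^ e) c) f := fun _ _ => rfl
  have hk : Submodule.restrictScalars k (frobPowIdeal k p d e) = LinearMap.ker Γ := by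
    ext f
    rw [Submodule.restrictScalars_mem, mem_frobPowIdeal_iff, LinearMap.mem_ker]
    constructor
    · intro h
      ext c
      by_contra hc
      obtain ⟨j, hj⟩ := h _ hc
      rw [boxExp_apply] at hj
      exact absurd (c j).2 (not_lt.2 hj)
    · intro h a ha
      by_contra! hlt
      apply ha
      have := congrFun h (fun j => ⟨a j, hlt j⟩)
      rw [hΓ] at this
      have h2 : a = boxExp (n := fun _ => p ^ e) (fun j => ⟨a j, hlt j⟩) := by
        ext j; rfl
      rw [h2]; exact this
  have hs : Function.Surjective Γ := fun v => ⟨boxPoly (fun _ => p ^ e) v, by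
    ext c; rw [hΓ, coeff_boxPoly_boxExp]⟩
  exact (Submodule.quotEquivOfEq _ _ hk).trans (Γ.quotKerEquivOfSurjective hs)

instance frobQuot_finite (p e : ℕ) : Module.Finite k (frobQuot k p d e) :=
  Module.Finite.equiv (frobQuotEquiv p e).symm

theorem finrank_frobQuot (p e : ℕ) : Module.finrank k (frobQuot k p d e) = (p ^ e) ^ d := by
  rw [(frobQuotEquiv p e).finrank_eq]; simp

noncomputable instance frobQuot_module (p e : ℕ) :
    Module (MvPolynomial (Fin d) k) (frobQuot k p d e) :=
  inferInstanceAs (Module (MvPolynomial (Fin d) k)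
    (MvPolynomial (Fin d) k ⧸ (frobPowIdeal k p d e)))

/-- the projection -/
noncomputable def frobMk (p e : ℕ) : MvPolynomial (Fin d) k →ₗ[k] frobQuot k p d e :=
  Submodule.mkQ (Submodule.restrictScalars k (frobPowIdeal k p d e))

theorem frobMk_surj (p e : ℕ) : Function.Surjective (frobMk (k := k) (d := d) p e) :=
  Submodule.mkQ_surjective _

theorem frobMk_eq_zero (p e : ℕ) (f : MvPolynomial (Fin d) k) :
    frobMk p e f = 0 ↔ f ∈ frobPowIdeal k p d e :=
  Submodule.Quotient.mk_eq_zero (Submodule.restrictScalars k (frobPowIdeal k p d e))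

theorem smul_frobMk (p e : ℕ) (s f : MvPolynomial (Fin d) k) :
    s • frobMk p e f = frobMk p e (s * f) := rfl

instance frobQuot_tower (p e : ℕ) :
    IsScalarTower k (MvPolynomial (Fin d) k) (frobQuot k p d e) where
  smul_assoc c s m := by
    obtain ⟨f, rfl⟩ := frobMk_surj p e m
    rw [smul_frobMk, smul_frobMk, ← map_smul, smul_mul_assoc]

theorem finrank_ker_le_s1 (p e : ℕ) (δ : MvPolynomial (Fin d) k) (hδ : δ ≠ 0) :
    Module.finrank k (LinearMap.ker (Algebra.lsmul k k (frobQuot k p d e) δ)) +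
      ∏ j, (p ^ e - MonomialOrder.lex.degree δ j) ≤ (p ^ e) ^ d := by
  set a := MonomialOrder.lex.degree δ
  let n : Fin d → ℕ := fun j => p ^ e - a j
  let τ : ((∀ j, Fin (n j)) → k) →ₗ[k] frobQuot k p d e :=
    Algebra.lsmul k k (frobQuot k p d e) δ ∘ₗ frobMk p e ∘ₗ boxPoly n
  have hτ : Function.Injective τ := by
    rw [← LinearMap.ker_eq_bot, LinearMap.ker_eq_bot']
    intro v hv
    by_contra hv0
    have hP : boxPoly n v ≠ 0 := by
      intro h
      apply hv0
      ext c
      rw [← coeff_boxPoly_boxExp n v c, h]; simp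
    have hv' : frobMk p e (δ * boxPoly n v) = 0 := hv
    rw [frobMk_eq_zero, mem_frobPowIdeal_iff] at hv'
    obtain ⟨j, hj⟩ := hv' (MonomialOrder.lex.degree (δ * boxPoly n v))
      (MonomialOrder.coeff_degree_ne_zero_iff.2 (mul_ne_zero hδ hP))
    rw [MonomialOrder.degree_mul hδ hP, Finsupp.add_apply] at hj
    have := lt_of_coeff_boxPoly n v _ (MonomialOrder.lex.coeff_degree_ne_zero_iff.2 hP) j
    simp only [n] at this hj
    change p ^ e ≤ a j + _ at hj
    omega
  have h1 : Module.finrank k ((∀ j, Fin (n j)) → k) ≤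
      Module.finrank k (LinearMap.range (Algebra.lsmul k k (frobQuot k p d e) δ)) := by
    rw [← LinearMap.finrank_range_of_inj hτ]
    exact Submodule.finrank_mono (LinearMap.range_comp_le_range _ _)
  have h2 := LinearMap.finrank_range_add_finrank_ker (Algebra.lsmul k k (frobQuot k p d e) δ)
  rw [finrank_frobQuot] at h2
  simp only [Module.finrank_fintype_fun_eq_card, Fintype.card_pi, Fintype.card_fin] at h1
  change ∏ j, (p ^ e - a j) ≤ _ at h1
  omega

end Box

theorem finite_of_irr (k : Type) [Field k] (G : Type) [Group G] [Fintype G] (M : Type)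
    [AddCommGroup M] [Module k M] [DistribMulAction G M]
    [SMulCommClass G k M] (h : IsIrreducibleRep k G M) : Module.Finite k M := by
  obtain ⟨hn, h⟩ := h
  obtain ⟨x, hx⟩ := exists_ne (0 : M)
  have := h (Submodule.span k (Set.range fun g : G => g • x)) (by
    intro g y hy
    induction hy using Submodule.span_induction with
    | mem y hy =>
      obtain ⟨t, rfl⟩ := hy
      exact Submodule.subset_span ⟨g * t, mul_smul _ _ _⟩
    | zero => simp
    | add y z _ _ hy hz => rw [smul_add]; exact add_mem hy hz
    | smul c y _ hy => rw [smul_comm]; exact Submodule.smul_mem _ _ hy)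
  rcases this with h | h
  · exact absurd (by
      have : x ∈ Submodule.span k (Set.range fun g : G => g • x) :=
        Submodule.subset_span ⟨1, one_smul _ _⟩
      rw [h] at this; simpa using this) hx
  · exact ⟨h ▸ Submodule.fg_span (Set.finite_range _)⟩

theorem limit_aux (p d : ℕ) (hp : 1 < p) (a : Fin d → ℕ) (H κ : ℕ → ℕ) (w c : ℕ) (hc : 0 < c)
    (hκ : ∀ e, κ e + ∏ j, (p ^ e - a j) ≤ (p ^ e) ^ d)
    (hu : ∀ e, c * H e ≤ w * (p ^ e) ^ d + c * (w * κ e))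
    (hl : ∀ e, w * (p ^ e) ^ d ≤ c * H e + w * κ e) :
    Filter.Tendsto (fun e : ℕ => (H e : ℝ) / (p : ℝ) ^ (d * e)) Filter.atTop
      (nhds ((w : ℝ) / c)) := by
  have hp0 : (0 : ℝ) < p := by positivity
  have hc' : (0 : ℝ) < c := by exact_mod_cast hc
  have hpow : ∀ e : ℕ, (p : ℝ) ^ (d * e) = ((p : ℝ) ^ e) ^ d := fun e => by
    rw [← pow_mul, mul_comm]
  have hQ : Filter.Tendsto (fun e : ℕ => (p : ℝ) ^ e) Filter.atTop Filter.atTop :=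
    tendsto_pow_atTop_atTop_of_one_lt (by exact_mod_cast hp)
  have hprod : Filter.Tendsto (fun e : ℕ => ∏ j, (1 - (a j : ℝ) / (p : ℝ) ^ e)) Filter.atTop
      (nhds (∏ j : Fin d, (1 - 0))) := by
    apply tendsto_finsetProd
    intro j _
    exact tendsto_const_nhds.sub (Filter.Tendsto.div_atTop tendsto_const_nhds hQ)
  simp only [sub_zero, Finset.prod_const_one] at hprod
  have hlim : Filter.Tendsto (fun e => (κ e : ℝ) / ((p : ℝ) ^ e) ^ d) Filter.atTop (nhds 0) := by
    have h1 : Filter.Tendsto (fun e : ℕ => 1 - ∏ j, (1 - (a j : ℝ) / (p : ℝ) ^ e)) Filter.atTop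
      (nhds 0) := by simpa using tendsto_const_nhds (x := (1 : ℝ)).sub hprod
    refine tendsto_of_tendsto_of_tendsto_of_le_of_le' tendsto_const_nhds h1
      (Filter.Eventually.of_forall fun e => by positivity) ?_
    have hev : ∀ᶠ e : ℕ in Filter.atTop, ∀ j, (a j : ℝ) ≤ (p : ℝ) ^ e :=
      Filter.eventually_all.2 fun j => hQ.eventually_ge_atTop _
    filter_upwards [hev] with e he
    have hq : (0 : ℝ) < (p : ℝ) ^ e := by positivity
    rw [div_le_iff₀ (by positivity), sub_mul, one_mul]
    have e1 : (∏ j, (1 - (a j : ℝ) / (p : ℝ) ^ e)) * ((p : ℝ) ^ e) ^ d =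
        ((∏ j, (p ^ e - a j) : ℕ) : ℝ) := by
      have : ((p : ℝ) ^ e) ^ d = ∏ _j : Fin d, (p : ℝ) ^ e := by simp
      rw [this, ← Finset.prod_mul_distrib, Nat.cast_prod]
      refine Finset.prod_congr rfl fun j _ => ?_
      rw [Nat.cast_sub (by exact_mod_cast he j)]
      push_cast
      field_simp
    rw [e1]
    have := hκ e
    have h3 : (κ e : ℝ) + ((∏ j, (p ^ e - a j) : ℕ) : ℝ) ≤ ((p : ℝ) ^ e) ^ d := by
      exact_mod_cast this
    linarith
  have hL : Filter.Tendsto (fun e => (w : ℝ) / c - w / c * ((κ e : ℝ) / ((p : ℝ) ^ e) ^ d))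
      Filter.atTop (nhds ((w : ℝ) / c)) := by
    simpa using tendsto_const_nhds (x := (w : ℝ) / c).sub (hlim.const_mul ((w : ℝ) / c))
  have hU : Filter.Tendsto (fun e => (w : ℝ) / c + w * ((κ e : ℝ) / ((p : ℝ) ^ e) ^ d))
      Filter.atTop (nhds ((w : ℝ) / c)) := by
    simpa using tendsto_const_nhds (x := (w : ℝ) / c).add (hlim.const_mul (w : ℝ))
  refine tendsto_of_tendsto_of_tendsto_of_le_of_le hL hU ?_ ?_
  · intro e
    have hq : (0 : ℝ) < ((p : ℝ) ^ e) ^ d := by positivity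
    have := hl e
    have h3 : (w : ℝ) * ((p : ℝ) ^ e) ^ d ≤ c * H e + w * κ e := by exact_mod_cast this
    simp only [hpow]
    rw [le_div_iff₀ hq]
    have : ((w : ℝ) / c - w / c * ((κ e : ℝ) / ((p : ℝ) ^ e) ^ d)) * ((p : ℝ) ^ e) ^ d =
      (w * ((p : ℝ) ^ e) ^ d - w * κ e) / c := by field_simp
    rw [this, div_le_iff₀ hc']
    linarith
  · intro e
    have hq : (0 : ℝ) < ((p : ℝ) ^ e) ^ d := by positivity
    have := hu e
    have h3 : (c : ℝ) * H e ≤ (w : ℝ) * ((p : ℝ) ^ e) ^ d + c * (w * κ e) := by exact_mod_cast this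
    simp only [hpow]
    rw [div_le_iff₀ hq]
    have : ((w : ℝ) / c + w * ((κ e : ℝ) / ((p : ℝ) ^ e) ^ d)) * ((p : ℝ) ^ e) ^ d =
      (w * ((p : ℝ) ^ e) ^ d + c * (w * κ e)) / c := by field_simp
    rw [this, le_div_iff₀ hc']
    linarith

theorem tendsto_dim_equivariantHom_div_pow
    (k : Type) [Field k] [IsAlgClosed k] (p : ℕ) [Fact p.Prime] [CharP k p]
    (d n : ℕ) (G : Type) [Group G] [Fintype G]
    [MulSemiringAction G (MvPolynomial (Fin d) k)]
    [SMulCommClass G k (MvPolynomial (Fin d) k)]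
    -- the order of `G` is not divisible by `p`
    (hord : ¬ p ∣ Fintype.card G)
    -- the action of `G` on `S` is induced by a linear action on `V = ⟨x_1, …, x_d⟩`
    (hlin : ∀ (g : G) (j : Fin d),
      g • (X j : MvPolynomial (Fin d) k) ∈ Submodule.span k (Set.range X))
    -- `G ⊆ GL(V)`: the action is faithful
    (hfaithful : ∀ g : G, (∀ s : MvPolynomial (Fin d) k, g • s = s) → g = 1)
    -- `V_0 = k, V_1, …, V_n`: a complete set of pairwise non-isomorphic irreducible
    -- representations of `G` over `k`, with `V_0` the trivial one-dimensional representation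
    (W : Fin (n + 1) → Type) [∀ i, AddCommGroup (W i)] [∀ i, Module k (W i)]
    [∀ i, DistribMulAction G (W i)] [∀ i, SMulCommClass G k (W i)]
    (hirr : ∀ i, IsIrreducibleRep k G (W i))
    (hdist : ∀ i j, i ≠ j → ¬ IsRepIso k G (W i) (W j))
    (hcomplete : ∀ (P : Type) [AddCommGroup P] [Module k P] [DistribMulAction G P]
      [SMulCommClass G k P], IsIrreducibleRep k G P → ∃ i, IsRepIso k G P (W i))
    (htriv : Module.finrank k (W 0) = 1 ∧ ∀ (g : G) (x : W 0), g • x = x) :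
    ∀ i : Fin (n + 1), Filter.Tendsto
      (fun e : ℕ =>
        (Module.finrank k (equivariantHom k p d G (W i) hlin e) : ℝ) / (p : ℝ) ^ (d * e))
      Filter.atTop
      (nhds ((Module.finrank k (W i) : ℝ) / (Fintype.card G : ℝ))) := by
  classical
  intro i
  haveI : Module.Finite k (W i) := finite_of_irr k G (W i) (hirr i)
  obtain ⟨b, hb⟩ := exists_dedMat_det_ne_zero (S := MvPolynomial (Fin d) k) (G := G) hfaithful
  have hρ : ∀ e g f, frobQuotAction k p d G hlin e g (frobMk p e f) = frobMk p e (g • f) :=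
    fun _ _ _ => rfl
  have h1 : ∀ e m, frobQuotAction k p d G hlin e 1 m = m := by
    intro e m
    obtain ⟨f, rfl⟩ := frobMk_surj p e m
    rw [hρ, one_smul]
  have hmul : ∀ e g h m, frobQuotAction k p d G hlin e (g * h) m =
      frobQuotAction k p d G hlin e g (frobQuotAction k p d G hlin e h m) := by
    intro e g h m
    obtain ⟨f, rfl⟩ := frobMk_surj p e m
    rw [hρ, hρ, hρ, mul_smul]
  have hs : ∀ e g (s : MvPolynomial (Fin d) k) m, frobQuotAction k p d G hlin e g (s • m) =
      (g • s) • frobQuotAction k p d G hlin e g m := by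
    intro e g s m
    obtain ⟨f, rfl⟩ := frobMk_surj p e m
    rw [hρ, smul_frobMk, smul_frobMk, hρ, smul_mul']
  refine limit_aux p d (Fact.out : p.Prime).one_lt
    (fun j => MonomialOrder.lex.degree (dedMat b).det j) _
    (fun e => Module.finrank k (LinearMap.ker
      (Algebra.lsmul k k (frobQuot k p d e) (dedMat b).det))) _ _ Fintype.card_pos
    (fun e => finrank_ker_le_s1 p e _ hb) (fun e => ?_) (fun e => ?_)
  · rw [← finrank_frobQuot (k := k)]
    exact upper_bound (frobQuotAction k p d G hlin e) (equivariantHom k p d G (W i) hlin e)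
      (h1 e) (hmul e) (hs e) (fun f => Iff.rfl) b
  · rw [← finrank_frobQuot (k := k)]
    exact lower_bound (frobQuotAction k p d G hlin e) (equivariantHom k p d G (W i) hlin e)
      (h1 e) (hmul e) (hs e) (fun f => Iff.rfl) b
end

section
/- The sequence e ↦ dim_k ((S/𝔪^{[p^e]})^G) / p^{de} converges as e → ∞, with limit 1/|G|. (This is the F-signature of R = S^G: s(R) = 1/|G|.) -/
/-!
The F-signature of `R = S^G` is `1/|G|`:
`dim_k ((S/𝔪^{[p^e]})^G) / p^{de} → 1/|G|` as `e → ∞`.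
Setting: `k` algebraically closed of characteristic `p > 0`, `S = k[x_1, …, x_d]`,
`G ⊆ GL(V)` finite, acting on `S` by `k`-algebra automorphisms induced by a linear action
on `V = ⟨x_1, …, x_d⟩`, with `p ∤ |G|`.
-/

set_option linter.unusedSectionVars false
set_option synthInstance.maxHeartbeats 1000000
set_option maxHeartbeats 1600000

open MvPolynomial TensorProduct

section Defs

variable (k : Type) [Field k] (p d : ℕ) [Fact p.Prime] [CharP k p]
variable (G : Type) [Group G] [Fintype G]
variable [MulSemiringAction G (MvPolynomial (Fin d) k)]
variable [SMulCommClass G k (MvPolynomial (Fin d) k)]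

/-- The `G`-invariants `(S/𝔪^{[p^e]})^G`. -/
def frobQuotInvariants
    (hlin : ∀ (g : G) (j : Fin d),
      g • (X j : MvPolynomial (Fin d) k) ∈ Submodule.span k (Set.range X))
    (e : ℕ) : Submodule k (frobQuot k p d e) where
  carrier := {x | ∀ g : G, frobQuotAction k p d G hlin e g x = x}
  add_mem' := by
    intro a b ha hb g
    rw [map_add, ha g, hb g]
  zero_mem' := by intro g; rw [map_zero]
  smul_mem' := by
    intro c x hx g
    rw [map_smul, hx g]

end Defs

section Helpers

variable (k : Type) [Field k] (p d : ℕ) [Fact p.Prime] [CharP k p]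
variable (G : Type) [Group G] [Fintype G]
variable [MulSemiringAction G (MvPolynomial (Fin d) k)]
variable [SMulCommClass G k (MvPolynomial (Fin d) k)]

/-- the class map. -/
noncomputable def fqMk (e : ℕ) : MvPolynomial (Fin d) k →ₗ[k] frobQuot k p d e :=
  Submodule.mkQ (Submodule.restrictScalars k (frobPowIdeal k p d e))

theorem fqMk_surj (e : ℕ) : Function.Surjective (fqMk k p d e) :=
  Submodule.mkQ_surjective _

theorem fqMk_eq_zero (e : ℕ) (f : MvPolynomial (Fin d) k) :
    fqMk k p d e f = 0 ↔ f ∈ frobPowIdeal k p d e :=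
  Submodule.Quotient.mk_eq_zero (Submodule.restrictScalars k (frobPowIdeal k p d e))

theorem act_fqMk (hlin : ∀ (g : G) (j : Fin d),
      g • (X j : MvPolynomial (Fin d) k) ∈ Submodule.span k (Set.range X))
    (e : ℕ) (g : G) (f : MvPolynomial (Fin d) k) :
    frobQuotAction k p d G hlin e g (fqMk k p d e f) = fqMk k p d e (g • f) := rfl

/-- multiplication -/
noncomputable def fqMulAux (e : ℕ) (f : MvPolynomial (Fin d) k) :
    frobQuot k p d e →ₗ[k] frobQuot k p d e :=
  Submodule.mapQ _ _ (LinearMap.mulLeft k f)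
    (fun _ hx => Ideal.mul_mem_left (frobPowIdeal k p d e) f hx)

theorem fqMulAux_mk (e : ℕ) (f g : MvPolynomial (Fin d) k) :
    fqMulAux k p d e f (fqMk k p d e g) = fqMk k p d e (f * g) := rfl

theorem fq_ext (e : ℕ) {φ ψ : frobQuot k p d e →ₗ[k] frobQuot k p d e}
    (h : ∀ f, φ (fqMk k p d e f) = ψ (fqMk k p d e f)) : φ = ψ := by
  ext x
  obtain ⟨f, rfl⟩ := fqMk_surj k p d e x
  exact h f

/-- multiplication as a ring hom -/
noncomputable def fqMul (e : ℕ) :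
    MvPolynomial (Fin d) k →+* Module.End k (frobQuot k p d e) where
  toFun f := fqMulAux k p d e f
  map_one' := fq_ext k p d e fun f => by simp [fqMulAux_mk]
  map_zero' := fq_ext k p d e fun f => by simp [fqMulAux_mk]
  map_mul' a b := fq_ext k p d e fun f => by simp [fqMulAux_mk, mul_assoc]
  map_add' a b := fq_ext k p d e fun f => by simp [fqMulAux_mk, add_mul]

theorem fqMul_mk (e : ℕ) (f g : MvPolynomial (Fin d) k) :
    fqMul k p d e f (fqMk k p d e g) = fqMk k p d e (f * g) := rfl

theorem act_fqMul (hlin : ∀ (g : G) (j : Fin d),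
      g • (X j : MvPolynomial (Fin d) k) ∈ Submodule.span k (Set.range X))
    (e : ℕ) (g : G) (f : MvPolynomial (Fin d) k) (x : frobQuot k p d e) :
    frobQuotAction k p d G hlin e g (fqMul k p d e f x) =
      fqMul k p d e (g • f) (frobQuotAction k p d G hlin e g x) := by
  obtain ⟨y, rfl⟩ := fqMk_surj k p d e x
  simp only [fqMul_mk, act_fqMk, smul_mul']

theorem act_act (hlin : ∀ (g : G) (j : Fin d),
      g • (X j : MvPolynomial (Fin d) k) ∈ Submodule.span k (Set.range X))
    (e : ℕ) (g h : G) (x : frobQuot k p d e) :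
    frobQuotAction k p d G hlin e g (frobQuotAction k p d G hlin e h x) =
      frobQuotAction k p d G hlin e (g * h) x := by
  obtain ⟨y, rfl⟩ := fqMk_surj k p d e x
  simp only [act_fqMk, mul_smul]

theorem act_one (hlin : ∀ (g : G) (j : Fin d),
      g • (X j : MvPolynomial (Fin d) k) ∈ Submodule.span k (Set.range X))
    (e : ℕ) (x : frobQuot k p d e) :
    frobQuotAction k p d G hlin e 1 x = x := by
  obtain ⟨y, rfl⟩ := fqMk_surj k p d e x
  simp only [act_fqMk, one_smul]

theorem det_kill (e : ℕ) {ι : Type} [Fintype ι] [DecidableEq ι]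
    (A : Matrix ι ι (MvPolynomial (Fin d) k)) (r : ι → frobQuot k p d e)
    (h : ∀ i, ∑ j, fqMul k p d e (A i j) (r j) = 0) (i : ι) :
    fqMul k p d e A.det (r i) = 0 := by
  have h1 : ∑ l, fqMul k p d e (A.adjugate i l) (∑ j, fqMul k p d e (A l j) (r j)) = 0 := by
    simp [h]
  have h2 : ∑ l, fqMul k p d e (A.adjugate i l) (∑ j, fqMul k p d e (A l j) (r j)) =
      ∑ j, fqMul k p d e ((A.adjugate * A) i j) (r j) := by
    simp only [map_sum, Matrix.mul_apply, LinearMap.sum_apply, map_mul, Module.End.mul_apply]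
    rw [Finset.sum_comm]
  rw [h2, Matrix.adjugate_mul] at h1
  rw [Finset.sum_eq_single i] at h1
  · simpa using h1
  · intro j _ hj
    simp [Matrix.one_apply, hj.symm]
  · simp

/-- exponent -/
noncomputable def expo (q : ℕ) (b : Fin d → Fin q) : Fin d →₀ ℕ :=
  Finsupp.equivFunOnFinite.symm fun i => (b i : ℕ)

theorem expo_inj (q : ℕ) : Function.Injective (expo d q) := by
  intro a b h
  funext i
  apply Fin.ext
  exact DFunLike.congr_fun h i

theorem mem_frob_iff (e : ℕ) (f : MvPolynomial (Fin d) k) :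
    f ∈ frobPowIdeal k p d e ↔ ∀ b : Fin d → Fin (p ^ e), f.coeff (expo d _ b) = 0 := by
  have h0 : frobPowIdeal k p d e = Ideal.span ((fun s => monomial s (1 : k)) ''
      (Set.range fun j : Fin d => Finsupp.single j (p ^ e))) := by
    rw [frobPowIdeal, ← Set.range_comp]
    congr 2
    funext j
    simp [X_pow_eq_monomial]
  rw [h0, mem_ideal_span_monomial_image]
  constructor
  · intro h b
    by_contra hb
    obtain ⟨_, ⟨j, rfl⟩, hj⟩ := h _ (mem_support_iff.2 hb)
    have := hj j
    simp [expo] at this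
    have := (b j).2
    omega
  · intro h s hs
    by_contra! hc
    have hlt : ∀ j, s j < p ^ e := by
      intro j
      by_contra! hj
      exact hc _ ⟨j, rfl⟩ (Finsupp.single_le_iff.2 hj)
    apply mem_support_iff.1 hs
    rw [← h fun j => ⟨s j, hlt j⟩]
    congr 1
    ext j
    rfl

/-- coefficient map -/
noncomputable def coeffMap (e : ℕ) :
    MvPolynomial (Fin d) k →ₗ[k] ((Fin d → Fin (p ^ e)) → k) :=
  LinearMap.pi fun b => MvPolynomial.lcoeff k (expo d _ b)

theorem coeffMap_surj (e : ℕ) : Function.Surjective (coeffMap k p d e) := by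
  classical
  intro v
  refine ⟨∑ b, monomial (expo d _ b) (v b), ?_⟩
  funext b
  simp [coeffMap, coeff_sum, coeff_monomial, (expo_inj d _).eq_iff]

theorem coeffMap_ker (e : ℕ) : LinearMap.ker (coeffMap k p d e) =
    Submodule.restrictScalars k (frobPowIdeal k p d e) := by
  ext f
  rw [LinearMap.mem_ker, Submodule.restrictScalars_mem, mem_frob_iff, funext_iff]
  rfl

/-- the equivalence -/
noncomputable def fqEquiv (e : ℕ) :
    frobQuot k p d e ≃ₗ[k] ((Fin d → Fin (p ^ e)) → k) :=
  (Submodule.quotEquivOfEq _ _ (coeffMap_ker k p d e).symm).trans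
    ((coeffMap k p d e).quotKerEquivOfSurjective (coeffMap_surj k p d e))

instance fq_finite (e : ℕ) : Module.Finite k (frobQuot k p d e) :=
  Module.Finite.equiv (fqEquiv k p d e).symm

theorem fq_finrank (e : ℕ) : Module.finrank k (frobQuot k p d e) = (p ^ e) ^ d := by
  rw [(fqEquiv k p d e).finrank_eq]
  simp

theorem card_bad_s2 (q : ℕ) (a : Fin d → ℕ) :
    (Finset.univ.filter fun b : Fin d → Fin q => ∃ i, (b i : ℕ) < a i).card * q ≤
      (∑ i, a i) * q ^ d := by
  classical
  have h1 : (Finset.univ.filter fun b : Fin d → Fin q => ∃ i, (b i : ℕ) < a i) ⊆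
      Finset.univ.biUnion fun i => Fintype.piFinset fun j : Fin d =>
        if j = i then (Finset.univ.filter fun c : Fin q => (c : ℕ) < a i) else Finset.univ := by
    intro b hb
    simp only [Finset.mem_filter, Finset.mem_univ, true_and] at hb
    obtain ⟨i, hi⟩ := hb
    simp only [Finset.mem_biUnion, Finset.mem_univ, true_and, Fintype.mem_piFinset]
    refine ⟨i, fun j => ?_⟩
    split_ifs with hj
    · subst hj; simpa using hi
    · simp
  refine (Nat.mul_le_mul_right _ ((Finset.card_le_card h1).trans Finset.card_biUnion_le)).trans ?_
  rw [Finset.sum_mul, Finset.sum_mul]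
  refine Finset.sum_le_sum fun i _ => ?_
  rw [Fintype.card_piFinset, ← Finset.mul_prod_erase _ _ (Finset.mem_univ i)]
  have h2 : ∏ x ∈ Finset.univ.erase i, (if x = i then
      (Finset.univ.filter fun c : Fin q => (c : ℕ) < a i) else Finset.univ).card = q ^ (d - 1) := by
    rw [Finset.prod_congr rfl (g := fun _ => q)]
    · simp
    · intro x hx
      simp [Finset.ne_of_mem_erase hx]
  have h3 : (Finset.univ.filter fun c : Fin q => (c : ℕ) < a i).card ≤ a i := by
    have := Finset.card_le_card_of_injOn (s := Finset.univ.filter fun c : Fin q => (c : ℕ) < a i)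
      (t := Finset.range (a i)) (fun c => (c : ℕ)) (by intro c hc; simpa using hc)
      (by intro x _ y _ h; exact Fin.ext h)
    simpa using this
  rw [h2]
  simp only [if_true]
  have hd : d - 1 + 1 = d := Nat.sub_add_cancel (Nat.lt_of_le_of_lt (Nat.zero_le _) i.2)
  calc _ = (Finset.univ.filter fun c : Fin q => (c : ℕ) < a i).card * q ^ (d - 1 + 1) := by ring
    _ ≤ _ := by rw [hd]; exact Nat.mul_le_mul_right _ h3

theorem ker_bound (D : MvPolynomial (Fin d) k) (hD : D ≠ 0) :
    ∃ C : ℕ, ∀ e, Module.finrank k (LinearMap.ker (fqMul k p d e D)) * p ^ e ≤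
      C * (p ^ e) ^ d := by
  classical
  let m : MonomialOrder (Fin d) := MonomialOrder.lex
  refine ⟨∑ i, m.degree D i, fun e => ?_⟩
  refine le_trans (Nat.mul_le_mul_right _ ?_) (card_bad_s2 d (p ^ e) (m.degree D))
  set B := Finset.univ.filter fun b : Fin d → Fin (p ^ e) => ∃ i, (b i : ℕ) < m.degree D i
  let v : (Fin d → Fin (p ^ e)) → frobQuot k p d e :=
    fun b => fqMk k p d e (monomial (expo d _ b) 1)
  have htop : LinearMap.range (fqMul k p d e D) ⊔
      Submodule.span k ((B.image v : Finset _) : Set (frobQuot k p d e)) = ⊤ := by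
    rw [eq_top_iff]
    rintro x -
    obtain ⟨f, rfl⟩ := fqMk_surj k p d e x
    obtain ⟨g, r, hf, -, hr⟩ := m.div
      (b := fun o : Option (Fin d) => o.elim D fun j => monomial (Finsupp.single j (p ^ e)) (1 : k))
      (by
        rintro (_ | j)
        · simpa [m.leadingCoeff_ne_zero_iff] using hD
        · simp [MonomialOrder.leadingCoeff_monomial]) f
    have hq : ∀ j, (monomial (Finsupp.single j (p ^ e)) (1 : k)) ∈ frobPowIdeal k p d e := by
      intro j
      rw [← X_pow_eq_monomial]
      exact Ideal.subset_span ⟨j, rfl⟩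
    rw [hf, map_add]
    refine add_mem ?_ ?_
    · rw [Finsupp.linearCombination_apply, Finsupp.sum, map_sum]
      refine sum_mem ?_
      rintro (_ | j) _
      · refine Submodule.mem_sup_left ⟨fqMk k p d e (g none), ?_⟩
        rw [fqMul_mk, smul_eq_mul, mul_comm]
        rfl
      · have : fqMk k p d e (g (some j) • monomial (Finsupp.single j (p ^ e)) (1 : k)) = 0 :=
          (fqMk_eq_zero k p d e _).2 (Ideal.mul_mem_left _ _ (hq j))
        exact this ▸ zero_mem _
    · rw [r.as_sum, map_sum]
      refine sum_mem fun c hc => Submodule.mem_sup_right ?_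
      have hlt : ∀ j, c j < p ^ e := by
        intro j
        by_contra! hj
        refine hr c hc (some j) ?_
        simp only [Option.elim, MonomialOrder.degree_monomial, one_ne_zero, if_false]
        exact Finsupp.single_le_iff.2 hj
      let b : Fin d → Fin (p ^ e) := fun j => ⟨c j, hlt j⟩
      have hb : expo d _ b = c := by ext j; rfl
      have hbB : b ∈ B := by
        simp only [B, Finset.mem_filter, Finset.mem_univ, true_and]
        by_contra! hcon
        exact hr c hc none fun i => hcon i
      have : fqMk k p d e (monomial c (coeff c r)) = coeff c r • v b := by
        simp only [v, hb, ← map_smul, smul_monomial, smul_eq_mul, mul_one]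
      rw [this]
      exact Submodule.smul_mem _ _ (Submodule.subset_span (Finset.mem_coe.2
        (Finset.mem_image_of_mem v hbB)))
  have h1 := Submodule.finrank_add_le_finrank_add_finrank (LinearMap.range (fqMul k p d e D))
      (Submodule.span k ((B.image v : Finset _) : Set (frobQuot k p d e)))
  rw [htop, finrank_top] at h1
  have h2 := LinearMap.finrank_range_add_finrank_ker (fqMul k p d e D)
  have h3 := finrank_span_finset_le_card (R := k) (B.image v)
  have h4 : (B.image v).card ≤ B.card := Finset.card_image_le
  have h5 : Module.finrank k (Submodule.span k ((B.image v : Finset _) :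
    Set (frobQuot k p d e))) ≤ (B.image v).card := h3
  omega

theorem exists_gen [Infinite k]
    (hfaithful : ∀ g : G, (∀ s : MvPolynomial (Fin d) k, g • s = s) → g = 1) :
    ∃ x : MvPolynomial (Fin d) k, Function.Injective fun g : G => g • x := by
  classical
  let P : {g : G // g ≠ 1} → Subspace k (MvPolynomial (Fin d) k) := fun g =>
    LinearMap.ker (DistribSMul.toLinearMap k (MvPolynomial (Fin d) k) g.1 - LinearMap.id)
  have hP : ⋃ g, (P g : Set (MvPolynomial (Fin d) k)) ≠ Set.univ := by
    intro h
    obtain ⟨g, hg⟩ := Subspace.exists_eq_top_of_iUnion_eq_univ h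
    apply g.2
    apply hfaithful
    intro s
    have : s ∈ P g := hg ▸ Submodule.mem_top
    exact sub_eq_zero.1 (LinearMap.mem_ker.1 this)
  obtain ⟨x, hx⟩ := (Set.ne_univ_iff_exists_notMem _).1 hP
  refine ⟨x, fun g h hgh => ?_⟩
  by_contra hne
  apply hx
  refine Set.mem_iUnion.2 ⟨⟨h⁻¹ * g, fun h1 => hne ?_⟩, ?_⟩
  · rw [inv_mul_eq_one] at h1; exact h1.symm
  · have : g • x = h • x := hgh
    refine LinearMap.mem_ker.2 (sub_eq_zero.2 ?_)
    change (h⁻¹ * g) • x = x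
    rw [mul_smul, this, inv_smul_smul]

theorem upper_bound_s2 (hlin : ∀ (g : G) (j : Fin d),
      g • (X j : MvPolynomial (Fin d) k) ∈ Submodule.span k (Set.range X))
    (e : ℕ) {ι : Type} [Fintype ι] [DecidableEq ι] (E : ι ≃ G)
    (f : ι → MvPolynomial (Fin d) k) :
    Fintype.card ι * Module.finrank k (frobQuotInvariants k p d G hlin e) ≤
      (p ^ e) ^ d + Fintype.card ι * Module.finrank k (LinearMap.ker
        (fqMul k p d e (Matrix.of fun i j => E i • f j).det)) := by
  set K := LinearMap.ker (fqMul k p d e (Matrix.of fun i j => E i • f j).det) with hK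
  let J := frobQuotInvariants k p d G hlin e
  let ψ : (ι → J) →ₗ[k] frobQuot k p d e :=
    ∑ i, (fqMul k p d e (f i)) ∘ₗ J.subtype ∘ₗ LinearMap.proj i
  have hψ : ∀ r, ψ r = ∑ i, fqMul k p d e (f i) (r i : frobQuot k p d e) := by
    intro r; simp [ψ]
  have hker : ∀ r ∈ LinearMap.ker ψ, ∀ i, (r i : frobQuot k p d e) ∈ K := by
    intro r hr i
    rw [LinearMap.mem_ker, hψ] at hr
    refine det_kill k p d e _ (fun i => (r i : frobQuot k p d e)) (fun l => ?_) i
    have := congrArg (frobQuotAction k p d G hlin e (E l)) hr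
    rw [map_sum, map_zero] at this
    rw [← this]
    refine Finset.sum_congr rfl fun j _ => ?_
    rw [act_fqMul, (r j).2 (E l)]
    rfl
  let θ : LinearMap.ker ψ →ₗ[k] (ι → K) := LinearMap.pi fun i =>
    LinearMap.codRestrict K (J.subtype ∘ₗ (LinearMap.proj (φ := fun _ : ι => J) i) ∘ₗ
      (LinearMap.ker ψ).subtype)
      (fun r => hker r.1 r.2 i)
  have hθ : Function.Injective θ := by
    intro r s h
    apply Subtype.ext
    funext i
    apply Subtype.ext
    exact congrArg (fun z : K => (z : frobQuot k p d e)) (congrFun h i)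
  have h1 := LinearMap.finrank_le_finrank_of_injective hθ
  have h2 := LinearMap.finrank_range_add_finrank_ker ψ
  have h3 := Submodule.finrank_le (LinearMap.range ψ)
  rw [fq_finrank] at h3
  rw [Module.finrank_pi_fintype] at h1 h2
  simp only [Finset.sum_const, Finset.card_univ, smul_eq_mul] at h1 h2
  change Fintype.card ι * Module.finrank k J ≤ _
  omega

theorem lower_bound_s2 (hlin : ∀ (g : G) (j : Fin d),
      g • (X j : MvPolynomial (Fin d) k) ∈ Submodule.span k (Set.range X))
    (e : ℕ) {ι : Type} [Fintype ι] [DecidableEq ι] (E : ι ≃ G)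
    (f : ι → MvPolynomial (Fin d) k) :
    (p ^ e) ^ d ≤ 
    Fintype.card ι * Module.finrank k (frobQuotInvariants k p d G hlin e) +
      Module.finrank k (LinearMap.ker
        (fqMul k p d e (Matrix.of fun i j => E i • f j).det)) := by
  set K := LinearMap.ker (fqMul k p d e (Matrix.of fun i j => E i • f j).det) with hK
  let J := frobQuotInvariants k p d G hlin e
  let tr : frobQuot k p d e →ₗ[k] frobQuot k p d e := ∑ g : G, frobQuotAction k p d G hlin e g
  have htr : ∀ x, tr x ∈ J := by
    intro x g
    simp only [tr, LinearMap.sum_apply, map_sum, act_act]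
    exact Fintype.sum_equiv (Equiv.mulLeft g) _ _ fun h => rfl
  let τ : frobQuot k p d e →ₗ[k] (ι → J) := LinearMap.pi fun i =>
    LinearMap.codRestrict J (tr ∘ₗ (fqMul k p d e (f i))) (fun x => htr _)
  have hker : LinearMap.ker τ ≤ K := by
    intro s hs
    have h0 : ∀ i, ∑ g : G, fqMul k p d e (g • f i) (frobQuotAction k p d G hlin e g s) = 0 := by
      intro i
      have h : (τ s i : frobQuot k p d e) = 0 := by rw [LinearMap.mem_ker.1 hs]; rfl
      rw [← h]
      simp only [τ, tr, LinearMap.pi_apply, LinearMap.codRestrict_apply, LinearMap.comp_apply,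
        LinearMap.sum_apply, act_fqMul]
    have h1 := det_kill k p d e (Matrix.of fun i j => E i • f j).transpose
      (fun i => frobQuotAction k p d G hlin e (E i) s) (fun i => by
        rw [← h0 i]
        exact Fintype.sum_equiv E _ _ fun h => rfl) (E.symm 1)
    rw [Matrix.det_transpose, Equiv.apply_symm_apply, act_one] at h1
    exact h1
  have h2 := LinearMap.finrank_range_add_finrank_ker τ
  have h3 := Submodule.finrank_le (LinearMap.range τ)
  have h4 := Submodule.finrank_mono hker
  rw [fq_finrank] at h2
  rw [Module.finrank_pi_fintype] at h3
  simp only [Finset.sum_const, Finset.card_univ, smul_eq_mul] at h3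
  change _ ≤ Fintype.card ι * Module.finrank k J + _
  omega

end Helpers

theorem F_signature_of_invariant_subring
    (k : Type) [Field k] [IsAlgClosed k] (p : ℕ) [Fact p.Prime] [CharP k p]
    (d : ℕ) (G : Type) [Group G] [Fintype G]
    [MulSemiringAction G (MvPolynomial (Fin d) k)]
    [SMulCommClass G k (MvPolynomial (Fin d) k)]
    -- the order of `G` is not divisible by `p`
    (hord : ¬ p ∣ Fintype.card G)
    -- the action of `G` on `S` is induced by a linear action on `V = ⟨x_1, …, x_d⟩`
    (hlin : ∀ (g : G) (j : Fin d),
      g • (X j : MvPolynomial (Fin d) k) ∈ Submodule.span k (Set.range X))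
    -- `G ⊆ GL(V)`: the action is faithful
    (hfaithful : ∀ g : G, (∀ s : MvPolynomial (Fin d) k, g • s = s) → g = 1) :
    Filter.Tendsto
      (fun e : ℕ =>
        (Module.finrank k (frobQuotInvariants k p d G hlin e) : ℝ) / (p : ℝ) ^ (d * e))
      Filter.atTop
      (nhds (1 / (Fintype.card G : ℝ))) := by
  classical
  have : Infinite k := IsAlgClosed.instInfinite
  obtain ⟨x, hx⟩ := exists_gen k d G hfaithful
  let E : Fin (Fintype.card G) ≃ G := (Fintype.equivFin G).symm
  let f : Fin (Fintype.card G) → MvPolynomial (Fin d) k := fun i => x ^ (i : ℕ)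
  have hA : (Matrix.of fun i j => E i • f j) = Matrix.vandermonde fun i => E i • x := by
    ext1 i j
    simp [f, Matrix.vandermonde_apply, smul_pow']
  have hD : (Matrix.of fun i j => E i • f j).det ≠ 0 := by
    rw [hA, Matrix.det_vandermonde_ne_zero_iff]
    exact hx.comp E.injective
  obtain ⟨C, hC⟩ := ker_bound k p d _ hD
  have hU := fun e => upper_bound_s2 k p d G hlin e E f
  have hL := fun e => lower_bound_s2 k p d G hlin e E f
  simp only [Fintype.card_fin] at hU hL
  have hn : (0 : ℝ) < (Fintype.card G : ℝ) := by exact_mod_cast (Fintype.card_pos : 0 < Fintype.card G)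
  have hp1 : (1 : ℝ) < p := by exact_mod_cast (Fact.out : p.Prime).one_lt
  have hlim : Filter.Tendsto (fun e : ℕ => (C : ℝ) * ((p : ℝ)⁻¹) ^ e) Filter.atTop (nhds 0) := by
    simpa using (tendsto_pow_atTop_nhds_zero_of_lt_one (by positivity)
      (inv_lt_one_of_one_lt₀ hp1)).const_mul (C : ℝ)
  rw [tendsto_iff_dist_tendsto_zero]
  refine squeeze_zero (fun _ => dist_nonneg) (fun e => ?_) hlim
  have hCe := hC e
  have hUe := hU e
  have hLe := hL e
  generalize Module.finrank k (LinearMap.ker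
        (fqMul k p d e (Matrix.of fun i j => E i • f j).det)) = κ at hCe hUe hLe
  generalize Module.finrank k (frobQuotInvariants k p d G hlin e) = a at hUe hLe ⊢
  have hq : (p : ℝ) ^ (d * e) = ((p : ℝ) ^ e) ^ d := by rw [← pow_mul, mul_comm]
  have hn1 : (1 : ℝ) ≤ (Fintype.card G : ℝ) := by exact_mod_cast (Fintype.card_pos : 0 < Fintype.card G)
  have hCr : (κ : ℝ) * (p : ℝ) ^ e ≤ C * ((p : ℝ) ^ e) ^ d := by exact_mod_cast hCe
  have hUr : (Fintype.card G : ℝ) * a ≤ ((p : ℝ) ^ e) ^ d + (Fintype.card G : ℝ) * κ := by exact_mod_cast hUe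
  have hLr : ((p : ℝ) ^ e) ^ d ≤ (Fintype.card G : ℝ) * a + κ := by exact_mod_cast hLe
  have hqe : (0 : ℝ) < (p : ℝ) ^ e := by positivity
  rw [hq]
  have hQ : (0 : ℝ) < ((p : ℝ) ^ e) ^ d := by positivity
  rw [inv_pow]
  generalize ((p : ℝ) ^ e) ^ d = Q at *
  generalize (p : ℝ) ^ e = q at *
  have hκ : (κ : ℝ) / Q ≤ C * q⁻¹ := by
    rw [← div_eq_mul_inv, div_le_div_iff₀ hQ hqe]
    exact hCr
  refine le_trans ?_ hκ
  have hκ0 : (0 : ℝ) ≤ κ := Nat.cast_nonneg _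
  rw [Real.dist_eq, div_sub_div _ _ hQ.ne' hn.ne', abs_div, abs_of_pos (mul_pos hQ hn),
    div_le_div_iff₀ (mul_pos hQ hn) hQ]
  have : |(a : ℝ) * (Fintype.card G : ℝ) - Q * 1| ≤ (Fintype.card G : ℝ) * κ := by
    rw [abs_le]
    constructor <;> nlinarith
  nlinarith
end
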